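/- arXiv:1606.04479 — 2 statements merged into one kernel-verified Lean document; each statement's English description precedes it below -/
import Mathlib

section
/- Let β > 0 and F₀ > 4β be constants, and take supercritical external force F(N) = F₀·N. Then there exist a constant C > 0 and N₀ ∈ ℕ such that for all N ≥ N₀, | m_1(N, F₀N) − (1 − √(4β/F₀)) | ≤ C/√N; that is, the conditional mean of the first spacing (the one adjacent to the endpoint y = 1) converges to 1 − √(4β/F₀) at rate O(N^{−1/2}). -/
open MeasureTheory Filter

noncomputable section

/-- The `k`-th spacing coordinate (for `1 ≤ k ≤ N`): for `k ≤ N-1` it is the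
`k`-th coordinate of `x`, and for `k = N` it is `1 - (x_1 + ⋯ + x_{N-1})`. -/
def coulombCoord (N k : ℕ) (x : Fin (N - 1) → ℝ) : ℝ :=
  if h : k - 1 < N - 1 then x ⟨k - 1, h⟩ else 1 - ∑ i, x i

/-- The open simplex `T_N ⊆ (0,1)^{N-1}`. -/
def coulombDomain (N : ℕ) : Set (Fin (N - 1) → ℝ) :=
  {x | (∀ i, 0 < x i ∧ x i < 1) ∧ ∑ i, x i < 1}

/-- `I_N[g] = ∫_{T_N} g · exp(−Σ_{i=1}^N (β/x_i + F·i·x_i))`. -/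
def coulombInt (β F : ℝ) (N : ℕ) (g : (Fin (N - 1) → ℝ) → ℝ) : ℝ :=
  ∫ x in coulombDomain N,
    g x * Real.exp (-(∑ k ∈ Finset.Icc 1 N,
      (β / coulombCoord N k x + F * (k : ℝ) * coulombCoord N k x)))

/-- Conditional mean `m_k(N,F)` of the `k`-th spacing. -/
def condMean (β : ℝ) (N : ℕ) (F : ℝ) (k : ℕ) : ℝ :=
  coulombInt β F N (coulombCoord N k) / coulombInt β F N (fun _ => 1)

/-- Conditional variance `v_k(N,F)` of the `k`-th spacing. -/
def condVar (β : ℝ) (N : ℕ) (F : ℝ) (k : ℕ) : ℝ :=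
  coulombInt β F N (fun x => coulombCoord N k x ^ 2) / coulombInt β F N (fun _ => 1)
    - condMean β N F k ^ 2


lemma cAbsInt {p q b : ℝ} (hp : 0 < p) (hq : -1 < q) (hb : 0 < b) :
    Integrable (fun t : ℝ => |t| ^ q * Real.exp (-b * |t| ^ p)) ∧
    ∫ t : ℝ, |t| ^ q * Real.exp (-b * |t| ^ p) =
      2 * (b ^ (-(q + 1) / p) * (1 / p) * Real.Gamma ((q + 1) / p)) := by
  have h : ∫ t : ℝ, |t| ^ q * Real.exp (-b * |t| ^ p) =
      2 * (b ^ (-(q + 1) / p) * (1 / p) * Real.Gamma ((q + 1) / p)) := by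
    rw [← integral_rpow_mul_exp_neg_mul_rpow hp hq hb]
    exact integral_comp_abs (f := fun t => t ^ q * Real.exp (-b * t ^ p))
  refine ⟨?_, h⟩
  apply Integrable.of_integral_ne_zero
  rw [h]
  have : 0 < Real.Gamma ((q + 1) / p) := Real.Gamma_pos_of_pos (div_pos (by linarith) hp)
  have := Real.rpow_pos_of_pos hb (-(q + 1) / p)
  positivity

/-- one-site weight -/
def cW (β a : ℝ) (x : ℝ) : ℝ := if 0 < x then Real.exp (-(β / x + a * x)) else 0

lemma cW_nonneg (β a x : ℝ) : 0 ≤ cW β a x := by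
  unfold cW; split_ifs <;> positivity

lemma cW_meas (β a : ℝ) : Measurable (cW β a) := by
  unfold cW
  exact Measurable.ite measurableSet_Ioi (by fun_prop) (by fun_prop)

lemma cW_eq {g b x : ℝ} (hb : 0 < b) (hx : 0 < x) :
    cW (g ^ 2) (b ^ 4) x = Real.exp (-(2 * g * b ^ 2)) *
      Real.exp (-(b ^ 4 * (x - g / b ^ 2) ^ 2 / x)) := by
  unfold cW
  rw [if_pos hx, ← Real.exp_add]
  congr 1
  field_simp
  ring

lemma cW_le {g b : ℝ} (hg : 0 < g) (hb : 0 < b) (x : ℝ) :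
    cW (g ^ 2) (b ^ 4) x ≤ Real.exp (-(2 * g * b ^ 2)) *
      (Real.exp (-(b ^ 6 / (2 * g)) * |x - g / b ^ 2| ^ (2:ℝ)) +
       Real.exp (-(b ^ 4 / 2) * |x - g / b ^ 2| ^ (1:ℝ))) := by
  by_cases hx : 0 < x
  · rw [cW_eq hb hx]
    apply mul_le_mul_of_nonneg_left _ (Real.exp_nonneg _)
    by_cases h : x ≤ 2 * (g / b ^ 2)
    · refine le_trans ?_ (le_add_of_nonneg_right (Real.exp_nonneg _))
      apply Real.exp_le_exp.2
      rw [Real.rpow_two, sq_abs, neg_mul, neg_le_neg_iff]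
      rw [le_div_iff₀ hx]
      calc b ^ 6 / (2 * g) * (x - g / b ^ 2) ^ 2 * x 
          ≤ b ^ 6 / (2 * g) * (x - g / b ^ 2) ^ 2 * (2 * (g / b ^ 2)) := by gcongr
        _ = _ := by field_simp
    · push Not at h
      refine le_trans ?_ (le_add_of_nonneg_left (Real.exp_nonneg _))
      apply Real.exp_le_exp.2
      have hm : 0 < g / b ^ 2 := by positivity
      rw [Real.rpow_one, neg_mul, neg_le_neg_iff, le_div_iff₀ hx, abs_of_pos (by linarith)]
      have h1 : (x - g / b ^ 2) * x ≤ 2 * (x - g / b ^ 2) ^ 2 := by nlinarith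
      have h2 : 0 < b ^ 4 := by positivity
      nlinarith
  · unfold cW
    rw [if_neg hx]
    positivity

lemma cW_int {g b : ℝ} (hg : 0 < g) (hb : 0 < b) : Integrable (cW (g ^ 2) (b ^ 4)) := by
  have h1 := (cAbsInt (p := 2) (q := 0) (b := b ^ 6 / (2 * g)) (by norm_num) (by norm_num)
    (by positivity)).1.comp_sub_right (g / b ^ 2)
  have h2 := (cAbsInt (p := 1) (q := 0) (b := b ^ 4 / 2) (by norm_num) (by norm_num)
    (by positivity)).1.comp_sub_right (g / b ^ 2)
  simp only [Real.rpow_zero, one_mul] at h1 h2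
  refine ((h1.add h2).const_mul (Real.exp (-(2 * g * b ^ 2)))).mono'
    (cW_meas _ _).aestronglyMeasurable (ae_of_all _ fun x => ?_)
  rw [Real.norm_of_nonneg (cW_nonneg _ _ _)]
  exact cW_le hg hb x

lemma cW_abs_int {g b : ℝ} (hg : 0 < g) (hb : 0 < b) :
    Integrable (fun x => |x - g / b ^ 2| * cW (g ^ 2) (b ^ 4) x) ∧
    ∫ x, |x - g / b ^ 2| * cW (g ^ 2) (b ^ 4) x ≤ 
      Real.exp (-(2 * g * b ^ 2)) * (2 * g / b ^ 6 + 8 / b ^ 8) := by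
  obtain ⟨h1, e1⟩ := (cAbsInt (p := 2) (q := 1) (b := b ^ 6 / (2 * g)) (by norm_num) (by norm_num)
    (by positivity))
  obtain ⟨h2, e2⟩ := (cAbsInt (p := 1) (q := 1) (b := b ^ 4 / 2) (by norm_num) (by norm_num)
    (by positivity))
  have i1 := h1.comp_sub_right (g / b ^ 2)
  have i2 := h2.comp_sub_right (g / b ^ 2)
  have hG := ((i1.add i2).const_mul (Real.exp (-(2 * g * b ^ 2))))
  have hle : ∀ x, |x - g / b ^ 2| * cW (g ^ 2) (b ^ 4) x ≤ Real.exp (-(2 * g * b ^ 2)) *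
      (|x - g / b ^ 2| ^ (1:ℝ) * Real.exp (-(b ^ 6 / (2 * g)) * |x - g / b ^ 2| ^ (2:ℝ)) +
       |x - g / b ^ 2| ^ (1:ℝ) * Real.exp (-(b ^ 4 / 2) * |x - g / b ^ 2| ^ (1:ℝ))) := by
    intro x
    have := mul_le_mul_of_nonneg_left (cW_le hg hb x) (abs_nonneg (x - g / b ^ 2))
    refine this.trans (le_of_eq ?_)
    rw [Real.rpow_one]
    ring
  have hI : Integrable (fun x => |x - g / b ^ 2| * cW (g ^ 2) (b ^ 4) x) := by
    refine hG.mono' (Measurable.aestronglyMeasurable (by have := cW_meas (g^2) (b^4); fun_prop))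
      (ae_of_all _ fun x => ?_)
    rw [Real.norm_of_nonneg (mul_nonneg (abs_nonneg _) (cW_nonneg _ _ _))]
    exact hle x
  refine ⟨hI, (integral_mono hI hG hle).trans (le_of_eq ?_)⟩
  rw [integral_const_mul]
  congr 1
  simp only [Pi.add_apply]
  rw [integral_add i1 i2]
  rw [integral_sub_right_eq_self (fun x => |x| ^ (1:ℝ) * Real.exp (-(b ^ 6 / (2 * g)) * |x| ^ (2:ℝ))),
    integral_sub_right_eq_self (fun x => |x| ^ (1:ℝ) * Real.exp (-(b ^ 4 / 2) * |x| ^ (1:ℝ))), e1, e2]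
  have a1 : (-((1:ℝ) + 1) / 2) = -1 := by norm_num
  have a2 : (-((1:ℝ) + 1) / 1) = -2 := by norm_num
  have a3 : (((1:ℝ) + 1) / 2) = 1 := by norm_num
  have a4 : (((1:ℝ) + 1) / 1) = 2 := by norm_num
  rw [a1, a2, a3, a4, Real.Gamma_one, Real.Gamma_two, Real.rpow_neg_one,
    Real.rpow_neg (by positivity), Real.rpow_two]
  field_simp
  ring

lemma cW_lower {g b : ℝ} (hg : 0 < g) (hb : 0 < b) :
    Real.exp (-(2 * g * b ^ 2)) * (Real.exp (-(1 / g)) / b ^ 3) ≤ ∫ x, cW (g ^ 2) (b ^ 4) x := by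
  have hm : 0 < g / b ^ 2 := by positivity
  have h1 : ∫ x in Set.Icc (g / b ^ 2) (g / b ^ 2 + 1 / b ^ 3), 
      Real.exp (-(2 * g * b ^ 2)) * Real.exp (-(1 / g)) ≤ 
      ∫ x in Set.Icc (g / b ^ 2) (g / b ^ 2 + 1 / b ^ 3), cW (g ^ 2) (b ^ 4) x := by
    apply setIntegral_mono_on (integrableOn_const (by simp)) (cW_int hg hb).integrableOn measurableSet_Icc
    intro x hx
    have hx0 : 0 < x := hm.trans_le hx.1
    rw [cW_eq hb hx0]
    apply mul_le_mul_of_nonneg_left _ (Real.exp_nonneg _)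
    apply Real.exp_le_exp.2
    rw [neg_le_neg_iff]
    have h2 : (x - g / b ^ 2) ^ 2 ≤ (1 / b ^ 3) ^ 2 := by
      apply pow_le_pow_left₀ (by linarith [hx.1]) (by linarith [hx.2])
    calc b ^ 4 * (x - g / b ^ 2) ^ 2 / x ≤ b ^ 4 * (1 / b ^ 3) ^ 2 / (g / b ^ 2) := by
          gcongr
          exact hx.1
      _ = _ := by field_simp
  have h3 := setIntegral_le_integral (s := Set.Icc (g / b ^ 2) (g / b ^ 2 + 1 / b ^ 3)) (cW_int hg hb)
    (ae_of_all _ fun x => cW_nonneg _ _ x)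
  refine le_trans (le_of_eq ?_) (h1.trans h3)
  rw [setIntegral_const]
  simp only [Real.volume_real_Icc, smul_eq_mul, add_sub_cancel_left]
  rw [max_eq_left (by positivity)]
  ring

/-- The one-dimensional estimate. -/
lemma cW_main {g b b0 : ℝ} (hg : 0 < g) (hb0 : 0 < b0) (hb : b0 ≤ b) :
    ∫ x, |x - g / b ^ 2| * cW (g ^ 2) (b ^ 4) x ≤ 
      (Real.exp (1 / g) * (2 * g + 8 / b0 ^ 2) / b ^ 3) * ∫ x, cW (g ^ 2) (b ^ 4) x := by
  have hbp : 0 < b := hb0.trans_le hb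
  refine (cW_abs_int hg hbp).2.trans ?_
  refine le_trans ?_ (mul_le_mul_of_nonneg_left (cW_lower hg hbp) (by positivity))
  have : (8 / b ^ 2) ≤ 8 / b0 ^ 2 := by gcongr
  calc _ = Real.exp (-(2 * g * b ^ 2)) * ((2 * g + 8 / b ^ 2) / b ^ 6) := by
        field_simp
    _ ≤ Real.exp (-(2 * g * b ^ 2)) * ((2 * g + 8 / b0 ^ 2) / b ^ 6) := by gcongr
    _ = _ := by
        rw [Real.exp_neg (1 / g)]
        field_simp

lemma cProd {ι : Type} [Fintype ι] (f : ι → ℝ → ℝ) (μ ε : ι → ℝ)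
    (h0 : ∀ i x, 0 ≤ f i x) (hf : ∀ i, Integrable (f i))
    (hf1 : ∀ i, Integrable (fun x => |x - μ i| * f i x))
    (hb : ∀ i, ∫ x, |x - μ i| * f i x ≤ ε i * ∫ x, f i x) (j : ι) :
    Integrable (fun x : ι → ℝ => |x j - μ j| * ∏ i, f i (x i)) ∧
    ∫ x : ι → ℝ, |x j - μ j| * ∏ i, f i (x i) ≤ ε j * ∫ x : ι → ℝ, ∏ i, f i (x i) := by
  classical
  set F : ι → ℝ → ℝ := Function.update f j (fun x => |x - μ j| * f j x) with hF
  have hne : ∀ i ∈ Finset.univ.erase j, F i = f i := fun i hi => by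
    rw [hF, Function.update_of_ne (Finset.ne_of_mem_erase hi)]
  have hj : F j = (fun x => |x - μ j| * f j x) := by rw [hF, Function.update_self]
  have e : (fun x : ι → ℝ => |x j - μ j| * ∏ i, f i (x i)) = fun x => ∏ i, F i (x i) := by
    funext x
    rw [← Finset.mul_prod_erase _ _ (Finset.mem_univ j),
      ← Finset.mul_prod_erase _ (fun i => F i (x i)) (Finset.mem_univ j), hj, ← mul_assoc]
    congr 1
    exact Finset.prod_congr rfl fun i hi => by rw [hne i hi]
  have hFi : ∀ i, Integrable (F i) := by
    intro i
    by_cases h : i = j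
    · subst h; rw [hj]; exact hf1 i
    · rw [hne i (by simp [h])]; exact hf i
  refine ⟨?_, ?_⟩
  · rw [e]; exact Integrable.fintype_prod hFi
  · rw [e, integral_fintype_prod_volume_eq_prod, integral_fintype_prod_volume_eq_prod]
    rw [← Finset.mul_prod_erase _ _ (Finset.mem_univ j),
      ← Finset.mul_prod_erase _ (fun i => ∫ x, f i x) (Finset.mem_univ j), hj, ← mul_assoc]
    rw [Finset.prod_congr rfl fun i hi => by rw [hne i hi]]
    exact mul_le_mul_of_nonneg_right (hb j)
      (Finset.prod_nonneg fun i _ => integral_nonneg (h0 i))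

lemma cProdSum {ι : Type} [Fintype ι] (f : ι → ℝ → ℝ) (μ ε : ι → ℝ) (s : ℝ)
    (h0 : ∀ i x, 0 ≤ f i x) (hf : ∀ i, Integrable (f i))
    (hf1 : ∀ i, Integrable (fun x => |x - μ i| * f i x))
    (hfm : ∀ i, Measurable (f i))
    (hb : ∀ i, ∫ x, |x - μ i| * f i x ≤ ε i * ∫ x, f i x) :
    Integrable (fun x : ι → ℝ => |∑ i, x i - s| * ∏ i, f i (x i)) ∧
    ∫ x : ι → ℝ, |∑ i, x i - s| * ∏ i, f i (x i) ≤
      (∑ i, ε i + |∑ i, μ i - s|) * ∫ x : ι → ℝ, ∏ i, f i (x i) := by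
  have hP : Integrable (fun x : ι → ℝ => ∏ i, f i (x i)) := Integrable.fintype_prod hf
  have hP0 : ∀ x : ι → ℝ, 0 ≤ ∏ i, f i (x i) := fun x => Finset.prod_nonneg fun i _ => h0 i _
  have hs : Integrable (fun x : ι → ℝ => ∑ j, |x j - μ j| * ∏ i, f i (x i)) :=
    integrable_finsetSum _ fun j _ => (cProd f μ ε h0 hf hf1 hb j).1
  have hG := hs.add (hP.const_mul |∑ i, μ i - s|)
  have hle : ∀ x : ι → ℝ, |∑ i, x i - s| * ∏ i, f i (x i) ≤
      ∑ j, |x j - μ j| * ∏ i, f i (x i) + |∑ i, μ i - s| * ∏ i, f i (x i) := by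
    intro x
    rw [← Finset.sum_mul, ← add_mul]
    apply mul_le_mul_of_nonneg_right _ (hP0 x)
    calc |∑ i, x i - s| = |∑ i, (x i - μ i) + (∑ i, μ i - s)| := by
          rw [Finset.sum_sub_distrib]; congr 1; ring
      _ ≤ _ := (abs_add_le _ _).trans (by gcongr; exact Finset.abs_sum_le_sum_abs _ _)
  have hI : Integrable (fun x : ι → ℝ => |∑ i, x i - s| * ∏ i, f i (x i)) := by
    refine hG.mono' (Measurable.aestronglyMeasurable (by fun_prop)) (ae_of_all _ fun x => ?_)
    rw [Real.norm_of_nonneg (mul_nonneg (abs_nonneg _) (hP0 x))]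
    exact hle x
  refine ⟨hI, (integral_mono hI hG hle).trans ?_⟩
  simp only [Pi.add_apply]
  rw [integral_add hs (hP.const_mul _), integral_finsetSum _ fun j _ => (cProd f μ ε h0 hf hf1 hb j).1,
    integral_const_mul, add_mul, Finset.sum_mul]
  gcongr with j
  exact (cProd f μ ε h0 hf hf1 hb j).2

/-- abstract comparison -/
lemma cCompare {ι : Type} [Fintype ι] (f : ι → ℝ → ℝ) (s E β : ℝ) (hβ : 0 < β) (hs : s < 1)
    (T : Set (ι → ℝ)) (hT : MeasurableSet T)
    (hTd : ∀ x, x ∈ T ↔ (∀ i, 0 < x i) ∧ ∑ i, x i < 1)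
    (h0 : ∀ i x, 0 ≤ f i x) (hz : ∀ i x, x ≤ 0 → f i x = 0) (hf : ∀ i, Integrable (f i))
    (hfm : ∀ i, Measurable (f i))
    (hpos : 0 < ∫ x : ι → ℝ, ∏ i, f i (x i))
    (hI : Integrable (fun x : ι → ℝ => |∑ i, x i - s| * ∏ i, f i (x i)))
    (hE : ∫ x : ι → ℝ, |∑ i, x i - s| * ∏ i, f i (x i) ≤ E * ∫ x : ι → ℝ, ∏ i, f i (x i))
    (hEs : E ≤ (1 - s) / 4) :
    |(∫ x in T, (1 - ∑ i, x i) * (Real.exp (-(β / (1 - ∑ i, x i))) * ∏ i, f i (x i))) /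
      (∫ x in T, (Real.exp (-(β / (1 - ∑ i, x i))) * ∏ i, f i (x i))) - (1 - s)| ≤
      2 * Real.exp (β / ((1 - s) / 2)) * E := by
  set P : (ι → ℝ) → ℝ := fun x => ∏ i, f i (x i) with hPdef
  have hP : Integrable P := Integrable.fintype_prod hf
  have hP0 : ∀ x, 0 ≤ P x := fun x => Finset.prod_nonneg fun i _ => h0 i _
  have hPm : Measurable P := by rw [hPdef]; fun_prop
  set Z := ∫ x, P x with hZ
  set H : (ι → ℝ) → ℝ := fun x => Real.exp (-(β / (1 - ∑ i, x i))) * P x with hHdef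
  have hHm : Measurable H := by rw [hHdef]; fun_prop
  have hH0 : ∀ x, 0 ≤ H x := fun x => mul_nonneg (Real.exp_nonneg _) (hP0 x)
  have hHP : ∀ x ∈ T, H x ≤ P x := by
    intro x hx
    have h1 := ((hTd x).1 hx).2
    apply mul_le_of_le_one_left (hP0 x)
    apply Real.exp_le_one_iff.2
    have : 0 < β / (1 - ∑ i, x i) := div_pos hβ (by linarith)
    linarith
  have hHi : IntegrableOn H T := by
    refine (hP.integrableOn (s := T)).mono' hHm.aestronglyMeasurable ?_
    filter_upwards [ae_restrict_mem hT] with x hx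
    rw [Real.norm_of_nonneg (hH0 x)]
    exact hHP x hx
  have hSm : IntegrableOn (fun x => (s - ∑ i, x i) * H x) T := by
    refine (hI.integrableOn (s := T)).mono' (Measurable.aestronglyMeasurable (by fun_prop)) ?_
    filter_upwards [ae_restrict_mem hT] with x hx
    rw [norm_mul, Real.norm_of_nonneg (hH0 x), Real.norm_eq_abs, abs_sub_comm]
    exact mul_le_mul_of_nonneg_left (hHP x hx) (abs_nonneg _)
  have hnum : |∫ x in T, (s - ∑ i, x i) * H x| ≤ E * Z := by
    refine le_trans ?_ hE
    refine le_trans ?_ (setIntegral_le_integral (s := T) hI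
      (ae_of_all _ fun x => mul_nonneg (abs_nonneg _) (hP0 x)))
    rw [← Real.norm_eq_abs]
    refine norm_integral_le_of_norm_le hI.integrableOn ?_
    filter_upwards [ae_restrict_mem hT] with x hx
    rw [norm_mul, Real.norm_of_nonneg (hH0 x), Real.norm_eq_abs, abs_sub_comm]
    exact mul_le_mul_of_nonneg_left (hHP x hx) (abs_nonneg _)
  set δ := (1 - s) / 2 with hδ
  have hδ0 : 0 < δ := by rw [hδ]; linarith
  have hden : Real.exp (-(β / δ)) / 2 * Z ≤ ∫ x in T, H x := by
    have hl : ∀ x, Real.exp (-(β / δ)) * (P x - (1 / δ) * (|∑ i, x i - s| * P x)) ≤ T.indicator H x := by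
      intro x
      by_cases hx : |∑ i, x i - s| < δ
      · by_cases hxp : ∀ i, 0 < x i
        · have hx' := abs_lt.1 hx
          have hxT : x ∈ T := (hTd x).2 ⟨hxp, by linarith [hx'.2]⟩
          rw [Set.indicator_of_mem hxT]
          apply mul_le_mul _ _ _ (Real.exp_nonneg _)
          · apply Real.exp_le_exp.2
            rw [neg_le_neg_iff]
            apply div_le_div_of_nonneg_left hβ.le hδ0
            linarith [hx'.2]
          · have : 0 ≤ (1 / δ) * (|∑ i, x i - s| * P x) :=
              mul_nonneg (by positivity) (mul_nonneg (abs_nonneg _) (hP0 x))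
            linarith
          · have : (1 / δ) * |∑ i, x i - s| ≤ 1 := by
              rw [one_div, inv_mul_le_iff₀ hδ0]; linarith
            nlinarith [hP0 x]
        · push Not at hxp
          obtain ⟨i, hi⟩ := hxp
          have : P x = 0 := Finset.prod_eq_zero (Finset.mem_univ i) (hz i _ hi)
          rw [this]
          simp only [mul_zero, sub_zero]
          exact Set.indicator_nonneg (fun x _ => hH0 x) x
      · refine le_trans ?_ (Set.indicator_nonneg (fun x _ => hH0 x) x)
        push Not at hx
        apply mul_nonpos_of_nonneg_of_nonpos (Real.exp_nonneg _)
        have : 1 ≤ (1 / δ) * |∑ i, x i - s| := by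
          rw [one_div, le_inv_mul_iff₀ hδ0]; linarith
        nlinarith [hP0 x]
    have hIntg := integral_mono ((hP.sub (hI.const_mul (1 / δ))).const_mul (Real.exp (-(β / δ))))
      (hHi.integrable_indicator hT) hl
    rw [integral_indicator hT] at hIntg
    refine le_trans ?_ hIntg
    simp only [Pi.sub_apply]
    rw [integral_const_mul, integral_sub hP (hI.const_mul (1 / δ)), integral_const_mul, div_mul_eq_mul_div,
      mul_div_assoc]
    apply mul_le_mul_of_nonneg_left _ (Real.exp_nonneg _)
    have h2 : (1 / δ) * ∫ x : ι → ℝ, |∑ i, x i - s| * P x ≤ Z / 2 := by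
      rw [one_div, inv_mul_le_iff₀ hδ0]
      refine hE.trans ?_
      have : E ≤ δ / 2 := by rw [hδ]; linarith
      nlinarith
    linarith
  have hDpos : 0 < ∫ x in T, H x := lt_of_lt_of_le (by positivity) hden
  have heq : (∫ x in T, (1 - ∑ i, x i) * H x) / (∫ x in T, H x) - (1 - s) =
      (∫ x in T, (s - ∑ i, x i) * H x) / (∫ x in T, H x) := by
    have : ∫ x in T, (1 - ∑ i, x i) * H x = ∫ x in T, ((s - ∑ i, x i) * H x + (1 - s) * H x) := by
      congr 1; funext x; ring
    rw [this, integral_add hSm (hHi.const_mul _), integral_const_mul]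
    field_simp
    ring
  rw [heq, abs_div, abs_of_pos hDpos, div_le_iff₀ hDpos]
  refine hnum.trans ?_
  have hE0 : 0 ≤ E := by
    by_contra h
    push Not at h
    have := abs_nonneg (∫ x in T, (s - ∑ i, x i) * H x)
    nlinarith
  refine le_trans (le_of_eq ?_) (mul_le_mul_of_nonneg_left hden (by positivity))
  rw [Real.exp_neg]
  field_simp

lemma cSumHalf (n : ℕ) :
    ∑ j ∈ Finset.range n, 1 / √((j:ℝ) + 1) ≤ 2 * √(n:ℝ) ∧
    2 * √((n:ℝ) + 1) - 2 ≤ ∑ j ∈ Finset.range n, 1 / √((j:ℝ) + 1) := by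
  induction n with
  | zero => simp
  | succ n ih =>
    rw [Finset.sum_range_succ]
    push_cast
    have h0 : 0 ≤ √(n:ℝ) := Real.sqrt_nonneg _
    have h1 : 0 < √((n:ℝ) + 1) := by positivity
    have h2 : 0 < √((n:ℝ) + 1 + 1) := by positivity
    have q0 : √(n:ℝ) ^ 2 = n := Real.sq_sqrt (by positivity)
    have q1 : √((n:ℝ) + 1) ^ 2 = n + 1 := Real.sq_sqrt (by positivity)
    have q2 : √((n:ℝ) + 1 + 1) ^ 2 = n + 1 + 1 := Real.sq_sqrt (by positivity)
    set p := √(n:ℝ)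
    set q := √((n:ℝ) + 1)
    set r := √((n:ℝ) + 1 + 1)
    have k1 : 1 / q ≤ 2 * (q - p) := by
      rw [div_le_iff₀ h1]; nlinarith [sq_nonneg (q - p)]
    have k2 : 2 * (r - q) ≤ 1 / q := by
      rw [le_div_iff₀ h1]; nlinarith [sq_nonneg (r - q)]
    constructor <;> linarith [ih.1, ih.2]

lemma cSumQuarter (n : ℕ) :
    ∑ j ∈ Finset.range n, 1 / √√((j:ℝ) + 1) ^ 3 ≤ 4 * √√(n:ℝ) := by
  induction n with
  | zero => simp
  | succ n ih =>
    rw [Finset.sum_range_succ]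
    push_cast
    have h0 : 0 ≤ √√(n:ℝ) := Real.sqrt_nonneg _
    have h1 : 0 < √√((n:ℝ) + 1) := by positivity
    have q0 : √√(n:ℝ) ^ 4 = n := by
      rw [show 4 = 2 * 2 from rfl, pow_mul, Real.sq_sqrt (by positivity), Real.sq_sqrt (by positivity)]
    have q1 : √√((n:ℝ) + 1) ^ 4 = n + 1 := by
      rw [show 4 = 2 * 2 from rfl, pow_mul, Real.sq_sqrt (by positivity), Real.sq_sqrt (by positivity)]
    have hle : √√(n:ℝ) ≤ √√((n:ℝ) + 1) := by gcongr; linarith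
    set p := √√(n:ℝ)
    set q := √√((n:ℝ) + 1)
    have k1 : 1 / q ^ 3 ≤ 4 * (q - p) := by
      rw [div_le_iff₀ (by positivity)]
      have e : (q - p) * (q ^ 3 + q ^ 2 * p + q * p ^ 2 + p ^ 3) = 1 := by linear_combination q1 - q0
      have a1 : q ^ 2 * p ≤ q ^ 2 * q := by gcongr
      have a2 : q * p ^ 2 ≤ q * q ^ 2 := by gcongr
      have a3 : p ^ 3 ≤ q ^ 3 := by gcongr
      rw [← e]
      nlinarith [mul_le_mul_of_nonneg_left (show q ^ 3 + q ^ 2 * p + q * p ^ 2 + p ^ 3 ≤ 4 * q ^ 3 by nlinarith) (sub_nonneg.2 hle)]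
    linarith

/-- The linear involution. -/
def cL (m : ℕ) : (Fin (m + 1) → ℝ) →ₗ[ℝ] (Fin (m + 1) → ℝ) where
  toFun x := Fin.cons (-∑ i, x i) (fun i => x i.succ)
  map_add' x y := by
    funext i
    refine Fin.cases ?_ (fun i => ?_) i
    · simp [Finset.sum_add_distrib]; ring
    · simp
  map_smul' c x := by
    funext i
    refine Fin.cases ?_ (fun i => ?_) i
    · simp [Finset.mul_sum]
    · simp

def cPhi (m : ℕ) (x : Fin (m + 1) → ℝ) : Fin (m + 1) → ℝ :=
  Fin.cons (1 - ∑ i, x i) (fun i => x i.succ)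

lemma cPhi_zero (m : ℕ) (x : Fin (m + 1) → ℝ) : cPhi m x 0 = 1 - ∑ i, x i := rfl

lemma cPhi_succ (m : ℕ) (x : Fin (m + 1) → ℝ) (i : Fin m) : cPhi m x i.succ = x i.succ := rfl

lemma cPhi_sum (m : ℕ) (x : Fin (m + 1) → ℝ) : 1 - ∑ i, cPhi m x i = x 0 := by
  rw [Fin.sum_univ_succ, cPhi_zero, Fin.sum_univ_succ]
  simp only [cPhi_succ]
  ring

lemma cPhi_invol (m : ℕ) : Function.Involutive (cPhi m) := by
  intro x
  funext i
  refine Fin.cases ?_ (fun i => ?_) i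
  · rw [cPhi_zero, cPhi_sum]
  · rw [cPhi_succ, cPhi_succ]

lemma cPhi_meas (m : ℕ) : Measurable (cPhi m) := by
  rw [measurable_pi_iff]
  intro i
  refine Fin.cases ?_ (fun i => ?_) i
  · simp only [cPhi_zero]; fun_prop
  · simp only [cPhi_succ]; fun_prop

lemma cL_det (m : ℕ) : |LinearMap.det (cL m)| = 1 := by
  have h : (cL m) * (cL m) = 1 := by
    refine LinearMap.ext fun x => funext fun j => ?_
    simp only [Module.End.mul_apply, Module.End.one_apply, cL, LinearMap.coe_mk, AddHom.coe_mk]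
    refine Fin.cases ?_ (fun j => ?_) j
    · rw [Fin.cons_zero, Fin.sum_univ_succ, Fin.cons_zero, Fin.sum_univ_succ]
      simp
    · simp
  have h2 : LinearMap.det (cL m) * LinearMap.det (cL m) = 1 := by
    rw [← map_mul, h, map_one]
  rcases mul_self_eq_one_iff.1 h2 with h | h <;> rw [h] <;> simp

lemma cPhi_mp (m : ℕ) : MeasurePreserving (cPhi m) := by
  have hd := cL_det m
  have h1 : MeasurePreserving (cL m) := by
    refine ⟨(LinearMap.continuous_of_finiteDimensional _).measurable, ?_⟩
    rw [Real.map_linearMap_volume_pi_eq_smul_volume_pi (by intro h; rw [h] at hd; simp at hd), abs_inv, hd]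
    simp
  have h2 : MeasurePreserving (fun x : Fin (m + 1) → ℝ => x + Pi.single 0 1) :=
    measurePreserving_add_right volume _
  have h3 := h2.comp h1
  convert h3 using 1
  funext x i
  refine Fin.cases ?_ (fun i => ?_) i
  · simp [cPhi, cL]; ring
  · simp [cPhi, cL]

lemma cPhi_integral (m : ℕ) (T : Set (Fin (m + 1) → ℝ)) (hT : ∀ x, cPhi m x ∈ T ↔ x ∈ T)
    (G : (Fin (m + 1) → ℝ) → ℝ) : ∫ x in T, G x = ∫ x in T, G (cPhi m x) := by
  have hemb : MeasurableEmbedding (cPhi m) :=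
    (MeasurableEquiv.ofInvolutive (cPhi m) (cPhi_invol m) (cPhi_meas m)).measurableEmbedding
  rw [← (cPhi_mp m).setIntegral_preimage_emb hemb]
  congr 2
  ext x
  exact hT x

lemma cDomain_iff (m : ℕ) (x : Fin (m + 1) → ℝ) :
    x ∈ coulombDomain (m + 2) ↔ (∀ i, 0 < x i) ∧ ∑ i, x i < 1 := by
  constructor
  · rintro ⟨h1, h2⟩
    exact ⟨fun i => (h1 i).1, h2⟩
  · rintro ⟨h1, h2⟩
    refine ⟨fun i => ⟨h1 i, lt_of_le_of_lt ?_ h2⟩, h2⟩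
    exact Finset.single_le_sum (f := x) (fun j _ => (h1 j).le) (Finset.mem_univ i)

lemma cDomain_phi (m : ℕ) (x : Fin (m + 1) → ℝ) :
    cPhi m x ∈ coulombDomain (m + 2) ↔ x ∈ coulombDomain (m + 2) := by
  have key : ∀ y : Fin (m + 1) → ℝ, y ∈ coulombDomain (m + 2) → cPhi m y ∈ coulombDomain (m + 2) := by
    intro y hy
    rw [cDomain_iff] at hy ⊢
    refine ⟨fun i => ?_, ?_⟩
    · refine Fin.cases ?_ (fun i => ?_) i
      · rw [cPhi_zero]; linarith [hy.2]
      · rw [cPhi_succ]; exact hy.1 _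
    · linarith [cPhi_sum m y, hy.1 0]
  refine ⟨fun h => ?_, key x⟩
  have := key _ h
  rwa [cPhi_invol] at this

lemma cDomain_meas (m : ℕ) : MeasurableSet (coulombDomain (m + 2) : Set (Fin (m + 1) → ℝ)) := by
  have : (coulombDomain (m + 2) : Set (Fin (m + 1) → ℝ)) =
      (⋂ i, {x | 0 < x i}) ∩ {x | ∑ i, x i < 1} := by
    ext x
    rw [cDomain_iff]
    simp
  rw [this]
  refine (MeasurableSet.iInter fun i => measurableSet_lt (by fun_prop) (by fun_prop)).inter
    (measurableSet_lt (by fun_prop) (by fun_prop))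

/-- weights after the change of variables -/
def cw (m : ℕ) : Fin (m + 1) → ℝ := Fin.cons ((m : ℝ) + 1) (fun i => (i : ℝ) + 1)

lemma cw_sum (m : ℕ) (q : ℝ → ℝ) :
    ∑ i, q (cw m i) = ∑ j ∈ Finset.range (m + 1), q ((j : ℝ) + 1) := by
  rw [Fin.sum_univ_succ, Finset.sum_range_succ, add_comm, Finset.sum_range]
  rfl

lemma cw_one_le (m : ℕ) (i : Fin (m + 1)) : 1 ≤ cw m i := by
  refine Fin.cases ?_ (fun i => ?_) i
  · simp [cw]
  · simp [cw]

lemma cCoord_one (m : ℕ) (x : Fin (m + 1) → ℝ) :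
    coulombCoord (m + 2) 1 (cPhi m x) = 1 - ∑ i, x i := by
  unfold coulombCoord
  rw [dif_pos (by omega)]
  exact cPhi_zero m x

lemma cCoord_last (m : ℕ) (x : Fin (m + 1) → ℝ) :
    coulombCoord (m + 2) (m + 2) (cPhi m x) = x 0 := by
  unfold coulombCoord
  rw [dif_neg (by omega)]
  exact cPhi_sum m x

lemma cCoord_mid (m : ℕ) (x : Fin (m + 1) → ℝ) (i : Fin m) :
    coulombCoord (m + 2) (i + 2) (cPhi m x) = x i.succ := by
  unfold coulombCoord
  rw [dif_pos (by have := i.2; omega)]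
  exact cPhi_succ m x i

lemma cEnergy (m : ℕ) (β F : ℝ) (x : Fin (m + 1) → ℝ) :
    ∑ k ∈ Finset.Icc 1 (m + 2), (β / coulombCoord (m + 2) k (cPhi m x) +
      F * (k : ℝ) * coulombCoord (m + 2) k (cPhi m x)) =
    F + β / (1 - ∑ i, x i) + ∑ i, (β / x i + F * cw m i * x i) := by
  have h1 : Finset.Icc 1 (m + 2) = Finset.Ico 1 (m + 3) := by ext; simp; omega
  rw [h1, Finset.sum_Ico_eq_sum_range, show m + 3 - 1 = m + 1 + 1 by omega,
    Finset.sum_range_succ, Finset.sum_range_succ', Finset.sum_range]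
  rw [show 1 + (m + 1) = m + 2 by omega, cCoord_last, show 1 + 0 = 1 by rfl, cCoord_one]
  have h2 : ∀ i : Fin m, (β / coulombCoord (m + 2) (1 + ((i : ℕ) + 1)) (cPhi m x) +
      F * ((1 + ((i : ℕ) + 1) : ℕ) : ℝ) * coulombCoord (m + 2) (1 + ((i : ℕ) + 1)) (cPhi m x)) =
      (β / x i.succ + F * cw m i.succ * x i.succ) + F * x i.succ := by
    intro i
    rw [show 1 + ((i : ℕ) + 1) = i + 2 by omega, cCoord_mid]
    simp only [cw, Fin.cons_succ]
    push_cast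
    ring
  rw [Finset.sum_congr rfl fun i _ => h2 i, Finset.sum_add_distrib, ← Finset.mul_sum,
    Fin.sum_univ_succ (fun i => (β / x i + F * cw m i * x i)), Fin.sum_univ_succ x]
  simp only [cw, Fin.cons_zero]
  push_cast
  ring

lemma cWeight (m : ℕ) (β F : ℝ) (x : Fin (m + 1) → ℝ) (hx : x ∈ coulombDomain (m + 2)) :
    Real.exp (-(∑ k ∈ Finset.Icc 1 (m + 2), (β / coulombCoord (m + 2) k (cPhi m x) +
      F * (k : ℝ) * coulombCoord (m + 2) k (cPhi m x)))) =
    Real.exp (-F) * (Real.exp (-(β / (1 - ∑ i, x i))) * ∏ i, cW β (F * cw m i) (x i)) := by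
  rw [cEnergy, neg_add, neg_add, Real.exp_add, Real.exp_add, mul_assoc, ← Finset.sum_neg_distrib,
    Real.exp_sum]
  congr 2
  refine Finset.prod_congr rfl fun i _ => ?_
  unfold cW
  rw [if_pos (((cDomain_iff m x).1 hx).1 i)]

lemma cMean (m : ℕ) (β F : ℝ) :
    condMean β (m + 2) F 1 =
    (∫ x in (coulombDomain (m + 2) : Set (Fin (m + 1) → ℝ)), (1 - ∑ i, x i) *
        (Real.exp (-(β / (1 - ∑ i, x i))) * ∏ i, cW β (F * cw m i) (x i))) /
      (∫ x in (coulombDomain (m + 2) : Set (Fin (m + 1) → ℝ)),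
        (Real.exp (-(β / (1 - ∑ i, x i))) * ∏ i, cW β (F * cw m i) (x i))) := by
  have h : ∀ g : (Fin (m + 1) → ℝ) → ℝ, coulombInt β F (m + 2) g =
      Real.exp (-F) * ∫ x in (coulombDomain (m + 2) : Set (Fin (m + 1) → ℝ)), g (cPhi m x) *
        (Real.exp (-(β / (1 - ∑ i, x i))) * ∏ i, cW β (F * cw m i) (x i)) := by
    intro g
    unfold coulombInt
    refine (cPhi_integral m (coulombDomain (m + 2)) (cDomain_phi m) _).trans ?_
    rw [← integral_const_mul]
    refine setIntegral_congr_fun (cDomain_meas m) fun x hx => ?_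
    show g (cPhi m x) * _ = _
    rw [cWeight m β F x hx]
    exact mul_left_comm _ _ _
  unfold condMean
  have h1 := h (coulombCoord (m + 2) 1)
  have h2 := h (fun _ => 1)
  simp only [cCoord_one, one_mul] at h1 h2
  refine (congrArg₂ (· / ·) h1 h2).trans ?_
  exact mul_div_mul_left _ _ (Real.exp_pos _).ne'

lemma cMain (m : ℕ) (β F₀ : ℝ) (hβ : 0 < β) (hF : 0 < F₀) (hs : √(4 * β / F₀) < 1)
    (A : ℝ) (hA : A = 4 * (Real.exp (1 / √β) * (2 * √β + 8 / √√F₀ ^ 2)) / √√F₀ ^ 3 + 2 * √β / √F₀)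
    (hN : A / √((m : ℝ) + 2) ≤ (1 - √(4 * β / F₀)) / 4) :
    |condMean β (m + 2) (F₀ * ((m : ℝ) + 2)) 1 - (1 - √(4 * β / F₀))| ≤
      2 * Real.exp (β / ((1 - √(4 * β / F₀)) / 2)) * (A / √((m : ℝ) + 2)) := by
  set g := √β with hg
  have hg0 : 0 < g := by positivity
  have hgβ : g ^ 2 = β := Real.sq_sqrt hβ.le
  set N : ℝ := (m : ℝ) + 2 with hNdef
  have hN0 : 0 < N := by positivity
  set b0 := √√F₀ with hb0
  have hb00 : 0 < b0 := by positivity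
  set c := √√N with hc
  have hc0 : 0 < c := by positivity
  have four : ∀ t : ℝ, 0 ≤ t → √√t ^ 4 = t := fun t ht => by
    rw [show 4 = 2 * 2 from rfl, pow_mul, Real.sq_sqrt (by positivity), Real.sq_sqrt ht]
  set K := Real.exp (1 / g) * (2 * g + 8 / b0 ^ 2) with hK
  have hK0 : 0 < K := by positivity
  set b : Fin (m + 1) → ℝ := fun i => b0 * c * √√(cw m i) with hb
  have hw0 : ∀ i, 0 < cw m i := fun i => lt_of_lt_of_le one_pos (cw_one_le m i)
  have hbb : ∀ i, b0 ≤ b i := by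
    intro i
    have h1 : 1 ≤ √√(cw m i) := Real.one_le_sqrt.2 (Real.one_le_sqrt.2 (cw_one_le m i))
    have h2 : 1 ≤ c := Real.one_le_sqrt.2 (Real.one_le_sqrt.2 (by rw [hNdef]; linarith [Nat.cast_nonneg (α := ℝ) m]))
    calc b0 = b0 * 1 * 1 := by ring
      _ ≤ b0 * c * √√(cw m i) := by gcongr
  have hbp : ∀ i, 0 < b i := fun i => hb00.trans_le (hbb i)
  have hb4 : ∀ i, b i ^ 4 = F₀ * N * cw m i := by
    intro i
    rw [hb]
    simp only [mul_pow]
    rw [hb0, hc, four _ hF.le, four _ hN0.le, four _ (hw0 i).le]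
  rw [cMean]
  have hfe : ∀ i, cW β (F₀ * N * cw m i) = cW (g ^ 2) (b i ^ 4) := fun i => by rw [hgβ, hb4]
  simp only [hfe]
  set f : Fin (m + 1) → ℝ → ℝ := fun i => cW (g ^ 2) (b i ^ 4) with hf
  have hIntg : ∀ i, Integrable (f i) := fun i => cW_int hg0 (hbp i)
  have hmeas : ∀ i, Measurable (f i) := fun i => cW_meas _ _
  have h0 : ∀ i x, 0 ≤ f i x := fun i x => cW_nonneg _ _ _
  obtain ⟨hI, hE⟩ := cProdSum f (fun i => g / b i ^ 2) (fun i => K / b i ^ 3) (√(4 * β / F₀)) h0 hIntg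
    (fun i => (cW_abs_int hg0 (hbp i)).1) hmeas (fun i => cW_main hg0 hb00 (hbb i))
  have hpos : 0 < ∫ x : Fin (m + 1) → ℝ, ∏ i, f i (x i) := by
    rw [integral_fintype_prod_volume_eq_prod]
    refine Finset.prod_pos fun i _ => lt_of_lt_of_le ?_ (cW_lower hg0 (hbp i))
    have := hbp i
    positivity
  have hsq : ∀ t : ℝ, √√t ^ 2 = √t := fun t => Real.sq_sqrt (Real.sqrt_nonneg t)
  have hc2 : c ^ 2 = √N := hsq N
  have hsum1 : ∑ i, K / b i ^ 3 ≤ 4 * K / b0 ^ 3 / √N := by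
    have e1 : ∀ i, K / b i ^ 3 = K / (b0 ^ 3 * c ^ 3) * (1 / √√(cw m i) ^ 3) := by
      intro i
      rw [hb]
      have := hw0 i
      field_simp
    rw [Finset.sum_congr rfl fun i _ => e1 i, ← Finset.mul_sum, cw_sum m (fun t => 1 / √√t ^ 3)]
    have h1 := cSumQuarter (m + 1)
    have h2 : √√((m + 1 : ℕ) : ℝ) ≤ c := by
      rw [hc, hNdef]; push_cast; gcongr; linarith
    calc _ ≤ K / (b0 ^ 3 * c ^ 3) * (4 * c) := by
          apply mul_le_mul_of_nonneg_left _ (by positivity); linarith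
      _ = _ := by rw [← hc2]; field_simp
  have hsum2 : |∑ i, g / b i ^ 2 - √(4 * β / F₀)| ≤ 2 * g / √F₀ / √N := by
    have e1 : ∀ i, g / b i ^ 2 = g / (√F₀ * √N) * (1 / √(cw m i)) := by
      intro i
      rw [hb]
      simp only [mul_pow]
      rw [hb0, hc, hsq, hsq, hsq]
      have := hw0 i
      field_simp
    have e2 : √(4 * β / F₀) = g / (√F₀ * √N) * (2 * √N) := by
      rw [Real.sqrt_div (by positivity), Real.sqrt_mul (by norm_num), show √(4:ℝ) = 2 by
        rw [show (4:ℝ) = 2 ^ 2 by norm_num]; exact Real.sqrt_sq (by norm_num), ← hg]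
      field_simp
    rw [Finset.sum_congr rfl fun i _ => e1 i, ← Finset.mul_sum, cw_sum m (fun t => 1 / √t), e2,
      ← mul_sub, abs_mul, abs_of_pos (by positivity)]
    have h1 := cSumHalf (m + 1)
    have h2 : √((m + 1 : ℕ) : ℝ) ≤ √N := by
      rw [hNdef]; push_cast; gcongr; linarith
    have h3 : √(((m + 1 : ℕ) : ℝ) + 1) = √N := by
      rw [hNdef]; push_cast; congr 1; ring
    rw [h3] at h1
    calc _ ≤ g / (√F₀ * √N) * 2 := by
          apply mul_le_mul_of_nonneg_left _ (by positivity)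
          rw [abs_le]
          constructor <;> linarith [h1.1, h1.2]
      _ = _ := by field_simp
  have hEA : ∑ i, K / b i ^ 3 + |∑ i, g / b i ^ 2 - √(4 * β / F₀)| ≤ A / √N := by
    rw [hA, add_div]
    exact add_le_add hsum1 hsum2
  exact cCompare f (√(4 * β / F₀)) (A / √N) β hβ hs _ (cDomain_meas m) (cDomain_iff m) h0
    (fun i x hx => if_neg (not_lt.2 hx)) hIntg hmeas hpos hI
    (hE.trans (mul_le_mul_of_nonneg_right hEA hpos.le)) hN

/-- Weak supercritical force `F = F₀N`, `F₀ > 4β`: the first spacing has mean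
`1 − √(4β/F₀) + O(N^{−1/2})`. -/
theorem mean_first_spacing_supercritical (β F₀ : ℝ) (hβ : 0 < β) (hF₀ : 4 * β < F₀) :
    ∃ C > (0:ℝ), ∃ N₀ : ℕ, ∀ N ≥ N₀,
      |condMean β N (F₀ * N) 1 - (1 - Real.sqrt (4 * β / F₀))| ≤ C / Real.sqrt N := by
  have hF : 0 < F₀ := by linarith
  have hs : √(4 * β / F₀) < 1 := by
    rw [Real.sqrt_lt' one_pos, one_pow, div_lt_one hF]
    exact hF₀
  set A := 4 * (Real.exp (1 / √β) * (2 * √β + 8 / √√F₀ ^ 2)) / √√F₀ ^ 3 + 2 * √β / √F₀ with hA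
  have hA0 : 0 < A := by positivity
  have hlim : Tendsto (fun n : ℕ => A / √(n : ℝ)) atTop (nhds 0) :=
    (Real.tendsto_sqrt_atTop.comp tendsto_natCast_atTop_atTop).const_div_atTop A
  have hev := hlim.eventually (ge_mem_nhds (show (0:ℝ) < (1 - √(4 * β / F₀)) / 4 by linarith))
  obtain ⟨N₁, hN₁⟩ := eventually_atTop.1 hev
  refine ⟨2 * Real.exp (β / ((1 - √(4 * β / F₀)) / 2)) * A, by positivity, max N₁ 2, ?_⟩
  intro N hN
  have h2 : 2 ≤ N := le_of_max_le_right hN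
  obtain ⟨m, rfl⟩ := Nat.exists_eq_add_of_le' h2
  have h1 := hN₁ (m + 2) (le_of_max_le_left hN)
  have h := cMain m β F₀ hβ hF hs A hA (by push_cast at h1; exact h1)
  refine le_trans (le_of_eq ?_) (h.trans (le_of_eq ?_))
  · push_cast; rfl
  · push_cast; ring
end
end

section
/- Let β > 0 and F₀ > 4β be constants, and take supercritical external force F(N) = F₀·N. Then there exist a constant C > 0 and N₀ ∈ ℕ such that for all N ≥ N₀, the conditional variance of the first spacing satisfies 0 ≤ v_1(N, F₀N) ≤ C·N^{−3/4}. -/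
open MeasureTheory Filter

noncomputable section

/-- one dimensional weight -/
def wt (β c t : ℝ) : ℝ := Real.exp (-(β / t + c * t))

lemma wt_pos (β c t : ℝ) : 0 < wt β c t := Real.exp_pos _

lemma wt_meas (β c : ℝ) : Measurable (wt β c) := by
  unfold wt; fun_prop

lemma wt_le {β c t : ℝ} (hβ : 0 < β) (ht : 0 < t) : wt β c t ≤ Real.exp (-c * t) := by
  unfold wt
  apply Real.exp_le_exp.2
  have : 0 < β / t := by positivity
  linarith

lemma int_pow_wt {β c : ℝ} (hβ : 0 < β) (hc : 0 < c) (k : ℕ) :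
    IntegrableOn (fun t => t ^ k * wt β c t) (Set.Ioi 0) := by
  have h := integrableOn_rpow_mul_exp_neg_mul_rpow (p := 1) (s := (k : ℝ)) (b := c)
    (by have : (0:ℝ) ≤ k := Nat.cast_nonneg k
        linarith) one_pos hc
  refine Integrable.mono' h ?_ ?_
  · exact ((measurable_id.pow_const k).mul (wt_meas β c)).aestronglyMeasurable
  · refine (ae_restrict_mem measurableSet_Ioi).mono fun t ht => ?_
    have ht : 0 < t := ht
    have h1 := wt_le (c := c) hβ ht
    have := wt_pos β c t
    rw [Real.norm_of_nonneg (by positivity), Real.rpow_natCast, Real.rpow_one]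
    gcongr

lemma int_wt {β c : ℝ} (hβ : 0 < β) (hc : 0 < c) :
    IntegrableOn (wt β c) (Set.Ioi 0) := by
  simpa using int_pow_wt hβ hc 0

lemma int_inv_wt {β c : ℝ} (hβ : 0 < β) (hc : 0 < c) :
    IntegrableOn (fun t => t⁻¹ * wt β c t) (Set.Ioi 0) := by
  have h := (integrableOn_rpow_mul_exp_neg_mul_rpow (p := 1) (s := 0) (b := c)
    (by norm_num) one_pos hc).const_mul β⁻¹
  refine Integrable.mono' h ?_ ?_
  · exact ((measurable_id.inv).mul (wt_meas β c)).aestronglyMeasurable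
  · refine (ae_restrict_mem measurableSet_Ioi).mono fun t ht => ?_
    have ht : 0 < t := ht
    have := wt_pos β c t
    rw [Real.norm_of_nonneg (by positivity), Real.rpow_zero, Real.rpow_one, one_mul]
    have e : wt β c t = Real.exp (-(β / t)) * Real.exp (-c * t) := by
      unfold wt; rw [← Real.exp_add]; congr 1; ring
    rw [e, ← mul_assoc]
    gcongr
    have h2 : β / t ≤ Real.exp (β / t) := by linarith [Real.add_one_le_exp (β / t)]
    rw [Real.exp_neg, ← mul_inv]
    apply inv_anti₀ hβ
    calc β = t * (β / t) := by field_simp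
      _ ≤ _ := by gcongr

lemma wt_deriv (β c : ℝ) {t : ℝ} (ht : 0 < t) :
    HasDerivAt (wt β c) ((β / t ^ 2 - c) * wt β c t) t := by
  unfold wt
  have h1 : HasDerivAt (fun t : ℝ => β / t) (-β / t ^ 2) t := by
    have := (hasDerivAt_inv ht.ne').const_mul β
    simpa [div_eq_mul_inv] using this
  have h := ((h1.add ((hasDerivAt_id t).const_mul c)).neg).exp
  refine (h.congr_deriv ?_)
  simp only [Pi.neg_apply, Pi.add_apply, id]
  ring

lemma ibp {β c : ℝ} (hβ : 0 < β) (hc : 0 < c) (k : ℕ)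
    (hintg : IntegrableOn (fun t => ((k + 1 : ℕ) : ℝ) * (t ^ k * wt β c t) + β * (t ^ (k + 1) / t ^ 2 * wt β c t)
      - c * (t ^ (k + 1) * wt β c t)) (Set.Ioi 0)) :
    ∫ t in Set.Ioi 0, (((k + 1 : ℕ) : ℝ) * (t ^ k * wt β c t) + β * (t ^ (k + 1) / t ^ 2 * wt β c t)
      - c * (t ^ (k + 1) * wt β c t)) = 0 := by
  have := integral_Ioi_of_hasDerivAt_of_tendsto (a := 0) (m := 0)
    (f := fun t => t ^ (k + 1) * wt β c t) ?_ ?_ hintg ?_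
  · simpa using this
  · have : Tendsto (fun t : ℝ => t ^ (k + 1)) (nhdsWithin 0 (Set.Ici 0)) (nhds 0) := by
      have : Continuous (fun t : ℝ => t ^ (k + 1)) := by fun_prop
      have h := this.tendsto 0
      rw [zero_pow (Nat.succ_ne_zero k)] at h
      exact h.mono_left nhdsWithin_le_nhds
    unfold ContinuousWithinAt
    simp only [ne_eq, Nat.succ_ne_zero, not_false_eq_true, zero_pow, zero_mul]
    refine squeeze_zero' ?_ ?_ this
    · filter_upwards [self_mem_nhdsWithin] with t ht
      have ht : 0 ≤ t := ht
      have := wt_pos β c t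
      positivity
    · filter_upwards [self_mem_nhdsWithin] with t ht
      have ht : 0 ≤ t := ht
      have : wt β c t ≤ 1 := by
        unfold wt
        apply Real.exp_le_one_iff.2
        have : 0 ≤ β / t + c * t := by positivity
        linarith
      exact mul_le_of_le_one_right (by positivity) this
  · intro t ht
    have ht : 0 < t := ht
    have := (hasDerivAt_pow (k + 1) t).mul (wt_deriv β c ht)
    refine this.congr_deriv ?_
    simp only [Nat.add_sub_cancel]
    ring
  · have h := tendsto_rpow_mul_exp_neg_mul_atTop_nhds_zero ((k + 1 : ℕ) : ℝ) c hc
    refine squeeze_zero' ?_ ?_ h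
    · filter_upwards [eventually_gt_atTop 0] with t ht
      have := wt_pos β c t
      positivity
    · filter_upwards [eventually_gt_atTop 0] with t ht
      rw [Real.rpow_natCast]
      have h1 := wt_le (c := c) hβ ht
      gcongr

def ZZ (β c : ℝ) : ℝ := ∫ t in Set.Ioi 0, wt β c t
def mm (β c : ℝ) : ℝ := (∫ t in Set.Ioi 0, t * wt β c t) / ZZ β c
def ss (β c : ℝ) : ℝ := (∫ t in Set.Ioi 0, t ^ 2 * wt β c t) / ZZ β c

lemma ZZ_pos {β c : ℝ} (hβ : 0 < β) (hc : 0 < c) : 0 < ZZ β c := by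
  unfold ZZ
  rw [setIntegral_pos_iff_support_of_nonneg_ae]
  · have : Function.support (wt β c) = Set.univ := by
      ext t; simp [(wt_pos β c t).ne']
    simp [this]
  · exact Eventually.of_forall fun t => (wt_pos β c t).le
  · exact int_wt hβ hc

lemma mm_pos {β c : ℝ} (hβ : 0 < β) (hc : 0 < c) : 0 < mm β c := by
  unfold mm
  refine div_pos ?_ (ZZ_pos hβ hc)
  rw [setIntegral_pos_iff_support_of_nonneg_ae]
  · have : Function.support (fun t => t * wt β c t) ∩ Set.Ioi 0 = Set.Ioi 0 := by
      ext t; simp [(wt_pos β c t).ne']; intro h; exact h.ne'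
    rw [this]; simp
  · refine (ae_restrict_mem measurableSet_Ioi).mono fun t ht => ?_
    exact mul_nonneg (le_of_lt ht) (wt_pos β c t).le
  · simpa using int_pow_wt hβ hc 1

lemma ss_eq {β c : ℝ} (hβ : 0 < β) (hc : 0 < c) : 2 * mm β c + β = c * ss β c := by
  have hZ := ZZ_pos hβ hc
  have i0 := int_wt hβ hc
  have i1 : IntegrableOn (fun t => t * wt β c t) (Set.Ioi 0) := by simpa using int_pow_wt hβ hc 1
  have i2 := int_pow_wt hβ hc 2
  have e : Set.EqOn (fun t => ((1 + 1 : ℕ) : ℝ) * (t ^ 1 * wt β c t) + β * (t ^ (1 + 1) / t ^ 2 * wt β c t)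
      - c * (t ^ (1 + 1) * wt β c t)) (fun t => 2 * (t * wt β c t) + β * wt β c t - c * (t ^ 2 * wt β c t))
      (Set.Ioi 0) := by
    intro t ht
    have ht : t ≠ 0 := ne_of_gt ht
    simp only [pow_one, Nat.reduceAdd]
    rw [div_self (by positivity)]
    push_cast; ring
  have hi : IntegrableOn (fun t => 2 * (t * wt β c t) + β * wt β c t - c * (t ^ 2 * wt β c t)) (Set.Ioi 0) :=
    ((i1.const_mul 2).add (i0.const_mul β)).sub (i2.const_mul c)
  have h := ibp hβ hc 1 (hi.congr_fun e.symm measurableSet_Ioi)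
  rw [setIntegral_congr_fun measurableSet_Ioi e,
    integral_sub (f := fun t => 2 * (t * wt β c t) + β * wt β c t) ((i1.const_mul 2).add (i0.const_mul β)) (i2.const_mul c),
    integral_add (i1.const_mul 2) (i0.const_mul β), integral_const_mul, integral_const_mul,
    integral_const_mul] at h
  unfold mm ss
  change _ + β * ZZ β c - _ = 0 at h
  field_simp
  linarith

lemma mm_ge {β c : ℝ} (hβ : 0 < β) (hc : 0 < c) : mm β c + β ≤ c * mm β c ^ 2 := by
  have hZ := ZZ_pos hβ hc
  have hm := mm_pos hβ hc
  have i0 := int_wt hβ hc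
  have i1 : IntegrableOn (fun t => t * wt β c t) (Set.Ioi 0) := by simpa using int_pow_wt hβ hc 1
  have ii := int_inv_wt hβ hc
  have e : Set.EqOn (fun t => ((0 + 1 : ℕ) : ℝ) * (t ^ 0 * wt β c t) + β * (t ^ (0 + 1) / t ^ 2 * wt β c t)
      - c * (t ^ (0 + 1) * wt β c t)) (fun t => wt β c t + β * (t⁻¹ * wt β c t) - c * (t * wt β c t))
      (Set.Ioi 0) := by
    intro t ht
    have ht : t ≠ 0 := ne_of_gt ht
    have h7 : t ^ (0 + 1) / t ^ 2 = t⁻¹ := by field_simp; simp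
    simp only [h7]
    simp
  have hi : IntegrableOn (fun t => wt β c t + β * (t⁻¹ * wt β c t) - c * (t * wt β c t)) (Set.Ioi 0) :=
    (i0.add (ii.const_mul β)).sub (i1.const_mul c)
  have h := ibp hβ hc 0 (hi.congr_fun e.symm measurableSet_Ioi)
  rw [setIntegral_congr_fun measurableSet_Ioi e,
    integral_sub (f := fun t => wt β c t + β * (t⁻¹ * wt β c t)) (i0.add (ii.const_mul β)) (i1.const_mul c),
    integral_add i0 (ii.const_mul β), integral_const_mul,
    integral_const_mul] at h
  have hM : ∫ t in Set.Ioi 0, t * wt β c t = mm β c * ZZ β c := by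
    unfold mm; field_simp
  have hk : ∫ t in Set.Ioi 0, (2 / mm β c * wt β c t - (mm β c ^ 2)⁻¹ * (t * wt β c t)) ≤
      ∫ t in Set.Ioi 0, t⁻¹ * wt β c t := by
    refine setIntegral_mono_on ((i0.const_mul _).sub (i1.const_mul _)) ii measurableSet_Ioi ?_
    intro t ht
    have ht : 0 < t := ht
    have hw := wt_pos β c t
    have : t⁻¹ - (2 / mm β c - (mm β c ^ 2)⁻¹ * t) = (t - mm β c) ^ 2 / (t * mm β c ^ 2) := by
      field_simp; ring
    have h3 : 0 ≤ t⁻¹ - (2 / mm β c - (mm β c ^ 2)⁻¹ * t) := by rw [this]; positivity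
    nlinarith
  rw [integral_sub (i0.const_mul _) (i1.const_mul _), integral_const_mul, integral_const_mul, hM] at hk
  rw [hM] at h
  change ZZ β c + _ - _ = 0 at h
  change _ * ZZ β c - _ ≤ _ at hk
  have : 2 / mm β c * ZZ β c - (mm β c ^ 2)⁻¹ * (mm β c * ZZ β c) = ZZ β c / mm β c := by
    field_simp; ring
  rw [this] at hk
  have h5 : ZZ β c + β * (ZZ β c / mm β c) ≤ c * (mm β c * ZZ β c) := by nlinarith
  have h6 : (ZZ β c / mm β c) * (mm β c + β) ≤ (ZZ β c / mm β c) * (c * mm β c ^ 2) := by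
    calc _ = ZZ β c + β * (ZZ β c / mm β c) := by field_simp
      _ ≤ _ := h5
      _ = _ := by field_simp
  exact le_of_mul_le_mul_left h6 (by positivity)

/-- normalized density -/
def dens (β c : ℝ) : ℝ → ℝ := Set.indicator (Set.Ioi 0) (fun t => wt β c t / ZZ β c)

lemma dens_meas (β c : ℝ) : Measurable (dens β c) :=
  ((wt_meas β c).div_const _).indicator measurableSet_Ioi

lemma dens_nonneg {β c : ℝ} (hβ : 0 < β) (hc : 0 < c) (t : ℝ) : 0 ≤ dens β c t := by
  unfold dens
  apply Set.indicator_nonneg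
  intro t _
  exact div_nonneg (wt_pos β c t).le (ZZ_pos hβ hc).le

lemma dens_int {β c : ℝ} (hβ : 0 < β) (hc : 0 < c) : Integrable (dens β c) := by
  unfold dens
  rw [integrable_indicator_iff measurableSet_Ioi]
  exact (int_wt hβ hc).div_const _

def nu (β c : ℝ) : Measure ℝ := volume.withDensity (fun t => ENNReal.ofReal (dens β c t))

lemma nu_integral {β c : ℝ} (hβ : 0 < β) (hc : 0 < c) (g : ℝ → ℝ) :
    ∫ t, g t ∂(nu β c) = (∫ t in Set.Ioi 0, g t * wt β c t) / ZZ β c := by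
  unfold nu
  rw [integral_withDensity_eq_integral_toReal_smul (dens_meas β c).ennreal_ofReal
    (Eventually.of_forall fun t => ENNReal.ofReal_lt_top), ← integral_div,
    ← integral_indicator measurableSet_Ioi]
  congr 1
  ext t
  rw [ENNReal.toReal_ofReal (dens_nonneg hβ hc t)]
  by_cases ht : t ∈ Set.Ioi (0:ℝ)
  · simp only [dens, Set.indicator_of_mem ht, smul_eq_mul]; ring
  · simp [dens, Set.indicator_of_notMem ht]

lemma nu_prob {β c : ℝ} (hβ : 0 < β) (hc : 0 < c) : IsProbabilityMeasure (nu β c) := by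
  constructor
  unfold nu
  rw [withDensity_apply _ MeasurableSet.univ, Measure.restrict_univ,
    ← ofReal_integral_eq_lintegral_ofReal (dens_int hβ hc)
      (Eventually.of_forall (dens_nonneg hβ hc))]
  unfold dens
  rw [integral_indicator measurableSet_Ioi, integral_div]
  change ENNReal.ofReal (ZZ β c / ZZ β c) = 1
  rw [div_self (ZZ_pos hβ hc).ne']; simp

lemma nu_memLp {β c : ℝ} (hβ : 0 < β) (hc : 0 < c) : MemLp id 2 (nu β c) := by
  rw [memLp_two_iff_integrable_sq measurable_id.aestronglyMeasurable]
  unfold nu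
  rw [integrable_withDensity_iff_integrable_smul' (dens_meas β c).ennreal_ofReal
    (Eventually.of_forall fun t => ENNReal.ofReal_lt_top)]
  have h : IntegrableOn (fun t => t ^ 2 * wt β c t / ZZ β c) (Set.Ioi 0) :=
    (int_pow_wt hβ hc 2).div_const _
  rw [← integrable_indicator_iff measurableSet_Ioi] at h
  refine h.congr (Eventually.of_forall fun t => ?_)
  simp only
  rw [ENNReal.toReal_ofReal (dens_nonneg hβ hc t)]
  by_cases ht : t ∈ Set.Ioi (0:ℝ)
  · simp only [dens, Set.indicator_of_mem ht, smul_eq_mul, id]; ring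
  · simp [dens, Set.indicator_of_notMem ht]

lemma nu_pos (β c : ℝ) : ∀ᵐ t ∂(nu β c), 0 < t := by
  unfold nu
  rw [ae_withDensity_iff (dens_meas β c).ennreal_ofReal]
  refine Eventually.of_forall fun t h => ?_
  by_contra ht
  apply h
  have ht : t ∉ Set.Ioi (0:ℝ) := ht
  simp [dens, Set.indicator_of_notMem ht]

lemma nu_mean {β c : ℝ} (hβ : 0 < β) (hc : 0 < c) : ∫ t, t ∂(nu β c) = mm β c := by
  rw [nu_integral hβ hc]; rfl

lemma nu_var {β c : ℝ} (hβ : 0 < β) (hc : 0 < c) :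
    ProbabilityTheory.variance id (nu β c) = ss β c - mm β c ^ 2 := by
  have := nu_prob hβ hc
  rw [ProbabilityTheory.variance_eq_sub (nu_memLp hβ hc)]
  congr 1
  · exact nu_integral hβ hc _
  · congr 1; exact nu_mean hβ hc

lemma nu_var_le {β c : ℝ} (hβ : 0 < β) (hc : 0 < c) :
    ProbabilityTheory.variance id (nu β c) ≤ mm β c / c := by
  rw [nu_var hβ hc, le_div_iff₀ hc]
  have := ss_eq hβ hc
  have := mm_ge hβ hc
  nlinarith

lemma mm_le {β c : ℝ} (hβ : 0 < β) (hc : 0 < c) : mm β c ≤ 2 / c + Real.sqrt (β / c) := by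
  have h0 := ProbabilityTheory.variance_nonneg id (nu β c)
  rw [nu_var hβ hc] at h0
  have h1 := ss_eq hβ hc
  have hm := mm_pos hβ hc
  set s := Real.sqrt (β / c) with hs
  have hs2 : s ^ 2 = β / c := Real.sq_sqrt (by positivity)
  have hs0 : 0 ≤ s := Real.sqrt_nonneg _
  by_contra hcon
  push Not at hcon
  have h2 : mm β c ^ 2 ≤ 2 / c * mm β c + s ^ 2 := by
    rw [hs2]
    have : ss β c = 2 / c * mm β c + β / c := by field_simp; linarith
    linarith
  have h3 : 0 < 2 / c := by positivity
  nlinarith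

lemma pi_nu {ι : Type} [Fintype ι] {β : ℝ} (hβ : 0 < β) (c : ι → ℝ) (hc : ∀ i, 0 < c i) :
    Measure.pi (fun i => nu β (c i)) =
      volume.withDensity (fun y : ι → ℝ => ENNReal.ofReal (∏ i, dens β (c i) (y i))) := by
  have hp : ∀ i, IsProbabilityMeasure (nu β (c i)) := fun i => nu_prob hβ (hc i)
  refine Measure.pi_eq fun s hs => ?_
  rw [withDensity_apply _ (MeasurableSet.univ_pi hs)]
  have hres : (volume : Measure (ι → ℝ)).restrict (Set.univ.pi s) =
      Measure.pi (fun i => (volume : Measure ℝ).restrict (s i)) := by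
    rw [volume_pi, Measure.restrict_pi_pi]
  rw [hres, ← ofReal_integral_eq_lintegral_ofReal]
  · rw [integral_fintype_prod_eq_prod (𝕜 := ℝ), ENNReal.ofReal_prod_of_nonneg]
    · refine Finset.prod_congr rfl fun i _ => ?_
      unfold nu
      rw [withDensity_apply _ (hs i), ofReal_integral_eq_lintegral_ofReal]
      · exact (dens_int hβ (hc i)).restrict
      · exact Eventually.of_forall (dens_nonneg hβ (hc i))
    · intro i _
      exact integral_nonneg (dens_nonneg hβ (hc i))
  · exact Integrable.fintype_prod fun i => (dens_int hβ (hc i)).restrict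
  · exact Eventually.of_forall fun y => Finset.prod_nonneg fun i _ => dens_nonneg hβ (hc i) _

/-- swap first and last spacing -/
def flipx (n : ℕ) (y : Fin (n + 1) → ℝ) : Fin (n + 1) → ℝ :=
  Fin.cons (1 - ∑ i, y i) (Fin.tail y)

lemma flipx_zero (n : ℕ) (y : Fin (n + 1) → ℝ) : flipx n y 0 = 1 - ∑ i, y i := rfl
lemma flipx_succ (n : ℕ) (y : Fin (n + 1) → ℝ) (i : Fin n) : flipx n y i.succ = y i.succ := rfl

lemma flipx_sum (n : ℕ) (y : Fin (n + 1) → ℝ) : 1 - ∑ i, flipx n y i = y 0 := by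
  rw [Fin.sum_univ_succ]
  simp only [flipx_zero, flipx_succ]
  rw [Fin.sum_univ_succ]; ring

lemma flipx_invol (n : ℕ) : Function.Involutive (flipx n) := by
  intro y
  ext i
  refine Fin.cases ?_ (fun i => ?_) i
  · rw [flipx_zero, flipx_sum]
  · rw [flipx_succ, flipx_succ]

lemma flipx_mp (n : ℕ) : MeasurePreserving (flipx n) := by
  have h1 := volume_preserving_piFinSuccAbove (fun _ : Fin (n + 1) => ℝ) 0
  have h2 : MeasurePreserving
      (fun p : (Fin n → ℝ) × ℝ => (p.1, (1 - ∑ i, p.1 i) - p.2))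
      (volume.prod volume) (volume.prod volume) := by
    refine MeasurePreserving.skew_product (f := id) (g := fun (a : Fin n → ℝ) (b : ℝ) => (1 - ∑ i, a i) - b)
      (MeasurePreserving.id _) ?_ ?_
    · simp only [Function.uncurry_def]; fun_prop
    · exact Eventually.of_forall fun a => (Measure.measurePreserving_sub_left volume _).map_eq
  have h3 : MeasurePreserving (Prod.swap : ℝ × (Fin n → ℝ) → _) (volume.prod volume) (volume.prod volume) :=
    Measure.measurePreserving_swap
  have h4 : MeasurePreserving (Prod.swap : (Fin n → ℝ) × ℝ → _) (volume.prod volume) (volume.prod volume) :=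
    Measure.measurePreserving_swap
  have h := (h1.symm).comp (h4.comp (h2.comp (h3.comp h1)))
  convert h using 1
  ext y i
  refine Fin.cases ?_ (fun i => ?_) i
  · simp [flipx_zero, MeasurableEquiv.piFinSuccAbove, Fin.sum_univ_succ, Fin.tail, Fin.insertNthEquiv]
    ring
  · simp [flipx_succ, MeasurableEquiv.piFinSuccAbove, Fin.tail, Fin.insertNthEquiv]

lemma mem_dom (n : ℕ) (x : Fin (n + 1) → ℝ) :
    x ∈ coulombDomain (n + 2) ↔ (∀ i, 0 < x i) ∧ ∑ i, x i < 1 := by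
  constructor
  · intro h; exact ⟨fun i => (h.1 i).1, h.2⟩
  · intro h
    refine ⟨fun i => ⟨h.1 i, ?_⟩, h.2⟩
    refine lt_of_le_of_lt ?_ h.2
    exact Finset.single_le_sum (f := x) (fun j _ => (h.1 j).le) (Finset.mem_univ i)

lemma flipx_dom (n : ℕ) : flipx n ⁻¹' (coulombDomain (n + 2)) = coulombDomain (n + 2) := by
  have key : ∀ x, x ∈ coulombDomain (n + 2) → flipx n x ∈ coulombDomain (n + 2) := by
    intro x hx
    rw [mem_dom] at hx ⊢
    refine ⟨fun i => ?_, ?_⟩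
    · refine Fin.cases ?_ (fun i => ?_) i
      · rw [flipx_zero]; linarith [hx.2]
      · exact hx.1 _
    · linarith [flipx_sum n x, hx.1 0]
  ext x
  refine ⟨fun h => ?_, key x⟩
  have := key _ h
  rwa [flipx_invol n x] at this

lemma dom_meas (n : ℕ) : MeasurableSet (coulombDomain (n + 2)) := by
  have : coulombDomain (n + 2) = {x : Fin (n+1) → ℝ | (∀ i, 0 < x i) ∧ ∑ i, x i < 1} := by
    ext x; exact mem_dom n x
  rw [this]
  refine MeasurableSet.inter (s₁ := {x : Fin (n+1) → ℝ | (∀ i, 0 < x i)}) (s₂ := {x : Fin (n+1) → ℝ | ∑ i, x i < 1}) ?_ ?_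
  · rw [Set.ofPred_forall]
    exact MeasurableSet.iInter fun i => measurableSet_lt measurable_const (measurable_pi_apply i)
  · exact measurableSet_lt (by fun_prop) measurable_const

/-- the tilt parameters -/
def cc (n : ℕ) (F : ℝ) (i : Fin (n + 1)) : ℝ :=
  F * (Fin.cons ((n : ℝ) + 1) (fun i : Fin n => (i : ℝ) + 1) : Fin (n + 1) → ℝ) i

lemma cc_zero (n : ℕ) (F : ℝ) : cc n F 0 = F * (n + 1) := rfl
lemma cc_succ (n : ℕ) (F : ℝ) (i : Fin n) : cc n F i.succ = F * (i + 1) := rfl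

lemma energy (n : ℕ) (β F : ℝ) (y : Fin (n + 1) → ℝ) :
    ∑ k ∈ Finset.Icc 1 (n + 2),
      (β / coulombCoord (n + 2) k (flipx n y) + F * (k : ℝ) * coulombCoord (n + 2) k (flipx n y)) =
    F + β / (1 - ∑ i, y i) + ∑ i, (β / y i + cc n F i * y i) := by
  have e : ∀ f : ℕ → ℝ, ∑ k ∈ Finset.Icc 1 (n + 2), f k = ∑ i : Fin (n + 1), f (i + 1) + f (n + 2) := by
    intro f
    rw [Finset.sum_Icc_succ_top (by omega)]
    congr 1
    rw [← Finset.sum_range (fun i => f (i + 1)), Finset.range_eq_Ico, Finset.sum_Ico_add' f 0 (n+1) 1]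
    rfl
  rw [e]
  have c1 : ∀ i : Fin (n + 1), coulombCoord (n + 2) (i + 1) (flipx n y) = flipx n y i := by
    intro i
    unfold coulombCoord
    rw [dif_pos (by have := i.2; omega)]
    rfl
  have c2 : coulombCoord (n + 2) (n + 2) (flipx n y) = y 0 := by
    unfold coulombCoord
    rw [dif_neg (by simp)]
    exact flipx_sum n y
  simp only [c1, c2]
  rw [Fin.sum_univ_succ, Fin.sum_univ_succ (f := fun i => β / y i + cc n F i * y i)]
  simp only [flipx_zero, flipx_succ, cc_zero, cc_succ]
  have hs : ∑ i : Fin n, (β / y i.succ + F * (((i.succ : Fin (n + 1)) : ℕ) + 1 : ℕ) * y i.succ) =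
      ∑ i : Fin n, (β / y i.succ + F * ((i : ℝ) + 1) * y i.succ) + F * ∑ i : Fin n, y i.succ := by
    rw [Finset.mul_sum, ← Finset.sum_add_distrib]
    refine Finset.sum_congr rfl fun i _ => ?_
    simp only [Fin.val_succ]
    push_cast; ring
  rw [hs, Fin.sum_univ_succ (f := y)]
  simp
  ring

lemma coulombInt_eq (n : ℕ) {β F : ℝ} (hβ : 0 < β) (hF : 0 < F) :
    ∃ K > 0, ∀ g : (Fin (n + 1) → ℝ) → ℝ, coulombInt β F (n + 2) g =
      K * ∫ y in coulombDomain (n + 2), g (flipx n y) * Real.exp (-(β / (1 - ∑ i, y i)))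
        ∂(Measure.pi (fun i => nu β (cc n F i))) := by
  have hc : ∀ i, 0 < cc n F i := by
    intro i
    refine Fin.cases ?_ (fun i => ?_) i
    · rw [cc_zero]; positivity
    · rw [cc_succ]; positivity
  refine ⟨Real.exp (-F) * ∏ i, ZZ β (cc n F i),
    mul_pos (Real.exp_pos _) (Finset.prod_pos fun i _ => ZZ_pos hβ (hc i)), fun g => ?_⟩
  have hemb : MeasurableEmbedding (flipx n) :=
    (MeasurableEquiv.mk ⟨flipx n, flipx n, flipx_invol n, flipx_invol n⟩
      (flipx_mp n).measurable (flipx_mp n).measurable).measurableEmbedding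
  unfold coulombInt
  have h := (flipx_mp n).setIntegral_preimage_emb hemb (fun x =>
    g x * Real.exp (-(∑ k ∈ Finset.Icc 1 (n + 2),
      (β / coulombCoord (n + 2) k x + F * (k : ℝ) * coulombCoord (n + 2) k x)))) (coulombDomain (n + 2))
  rw [flipx_dom] at h
  refine h.symm.trans ?_
  have hm : Measurable (fun y : Fin (n + 1) → ℝ => ENNReal.ofReal (∏ i, dens β (cc n F i) (y i))) := by
    refine Measurable.ennreal_ofReal ?_
    exact Finset.measurable_prod _ fun i _ => (dens_meas _ _).comp (measurable_pi_apply i)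
  rw [pi_nu hβ _ hc, restrict_withDensity (dom_meas n),
    integral_withDensity_eq_integral_toReal_smul hm
      (Eventually.of_forall fun t => ENNReal.ofReal_lt_top), ← integral_const_mul]
  refine setIntegral_congr_fun (dom_meas n) fun y hy => ?_
  have hy' := (mem_dom n y).1 hy
  rw [ENNReal.toReal_ofReal (Finset.prod_nonneg fun i _ => dens_nonneg hβ (hc i) _), energy]
  have hd : ∏ i, dens β (cc n F i) (y i) = (∏ i, wt β (cc n F i) (y i)) / ∏ i, ZZ β (cc n F i) := by
    rw [← Finset.prod_div_distrib]
    refine Finset.prod_congr rfl fun i _ => ?_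
    exact Set.indicator_of_mem (s := Set.Ioi (0:ℝ)) (hy'.1 i) _
  have hZ : 0 < ∏ i, ZZ β (cc n F i) := Finset.prod_pos fun i _ => ZZ_pos hβ (hc i)
  rw [hd, neg_add, neg_add, Real.exp_add, Real.exp_add, ← Finset.sum_neg_distrib, Real.exp_sum]
  simp only [wt, smul_eq_mul]
  field_simp

lemma cc_pos (n : ℕ) {F : ℝ} (hF : 0 < F) (i : Fin (n + 1)) : 0 < cc n F i := by
  refine Fin.cases ?_ (fun i => ?_) i
  · rw [cc_zero]; positivity
  · rw [cc_succ]; positivity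

lemma cc_ge (n : ℕ) {F : ℝ} (hF : 0 < F) (i : Fin (n + 1)) : F ≤ cc n F i := by
  refine Fin.cases ?_ (fun i => ?_) i
  · rw [cc_zero]; nlinarith [show (0:ℝ) ≤ n from Nat.cast_nonneg n]
  · rw [cc_succ]; nlinarith [show (0:ℝ) ≤ (i:ℕ) from Nat.cast_nonneg _]

lemma cc_sum (n : ℕ) (F : ℝ) (f : ℝ → ℝ) :
    ∑ i, f (cc n F i) = ∑ j ∈ Finset.range (n + 1), f (F * (j + 1)) := by
  rw [Fin.sum_univ_succ, Finset.sum_range_succ, add_comm, Finset.sum_range]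
  rfl

lemma sum_inv_sqrt (n : ℕ) : ∑ j ∈ Finset.range n, 1 / Real.sqrt ((j : ℝ) + 1) ≤ 2 * Real.sqrt n := by
  induction n with
  | zero => simp
  | succ n ih =>
    rw [Finset.sum_range_succ]
    push_cast
    set a := Real.sqrt n
    set b := Real.sqrt ((n:ℝ) + 1)
    have ha : a ^ 2 = n := Real.sq_sqrt (by positivity)
    have hb : b ^ 2 = n + 1 := Real.sq_sqrt (by positivity)
    have hb0 : 0 < b := Real.sqrt_pos.2 (by positivity)
    have : 1 / b ≤ 2 * b - 2 * a := by
      rw [div_le_iff₀ hb0]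
      nlinarith [sq_nonneg (a - b)]
    linarith

lemma mean_sum_le (n : ℕ) {β F₀ : ℝ} (hβ : 0 < β) (hF₀ : 0 < F₀) :
    ∑ i, mm β (cc n (F₀ * ((n + 2 : ℕ) : ℝ)) i) ≤
      4 / (F₀ * Real.sqrt ((n + 2 : ℕ) : ℝ)) + 2 * Real.sqrt (β / F₀) := by
  set M : ℝ := ((n + 2 : ℕ) : ℝ) with hM
  have hM0 : 0 < M := by positivity
  rw [cc_sum n _ (mm β)]
  set r := Real.sqrt M with hr
  have hr0 : 0 < r := Real.sqrt_pos.2 hM0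
  have hr2 : r ^ 2 = M := Real.sq_sqrt hM0.le
  set q := Real.sqrt (β / F₀) with hq
  have hq0 : 0 ≤ q := Real.sqrt_nonneg _
  have hS := sum_inv_sqrt (n + 1)
  have hS2 : ∑ j ∈ Finset.range (n + 1), 1 / Real.sqrt ((j : ℝ) + 1) ≤ 2 * r := by
    refine hS.trans ?_
    have : Real.sqrt ((n + 1 : ℕ) : ℝ) ≤ r := by
      apply Real.sqrt_le_sqrt; rw [hM]; push_cast; linarith
    linarith
  calc ∑ j ∈ Finset.range (n + 1), mm β (F₀ * M * (j + 1))
      ≤ ∑ j ∈ Finset.range (n + 1), (2 / (F₀ * M) + q / r) * (1 / Real.sqrt ((j : ℝ) + 1)) := by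
        refine Finset.sum_le_sum fun j _ => ?_
        have hj : (0:ℝ) < (j:ℝ) + 1 := by positivity
        refine (mm_le hβ (by positivity)).trans ?_
        rw [add_mul]
        have h1 : Real.sqrt ((j:ℝ) + 1) ≤ (j:ℝ) + 1 := by
          rw [Real.sqrt_le_left hj.le]
          nlinarith [show (0:ℝ) ≤ j from Nat.cast_nonneg j]
        have h0 : 0 < Real.sqrt ((j:ℝ) + 1) := Real.sqrt_pos.2 hj
        refine add_le_add ?_ (le_of_eq ?_)
        · rw [div_mul_div_comm, mul_one]
          gcongr
        · rw [show β / (F₀ * M * ((j:ℝ) + 1)) = β / F₀ / M / ((j:ℝ) + 1) by field_simp,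
            Real.sqrt_div (by positivity), Real.sqrt_div (by positivity)]
          ring
    _ = (2 / (F₀ * M) + q / r) * ∑ j ∈ Finset.range (n + 1), (1 / Real.sqrt ((j : ℝ) + 1)) := by
        rw [Finset.mul_sum]
    _ ≤ (2 / (F₀ * M) + q / r) * (2 * r) := by gcongr
    _ = _ := by rw [← hr2]; field_simp; ring

lemma abstract_bound {Ω : Type} [MeasurableSpace Ω] (μ : Measure Ω) [IsProbabilityMeasure μ]
    (S : Ω → ℝ) (hSm : Measurable S) (hS : MemLp S 2 μ) (D : Set Ω) (hD : MeasurableSet D)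
    (hD1 : ∀ y ∈ D, 0 < S y ∧ S y < 1) (hD2 : ∀ᵐ y ∂μ, S y < 1 → y ∈ D)
    (β δ : ℝ) (hβ : 0 < β) (hδ : 0 < δ) (hmean : ∫ y, S y ∂μ ≤ 1 - 2 * δ)
    (hvar : ProbabilityTheory.variance S μ ≤ δ ^ 2 / 2) (J0 J1 J2 : ℝ)
    (h0 : J0 = ∫ y in D, Real.exp (-(β / (1 - S y))) ∂μ)
    (h1 : J1 = ∫ y in D, (1 - S y) * Real.exp (-(β / (1 - S y))) ∂μ)
    (h2 : J2 = ∫ y in D, (1 - S y) ^ 2 * Real.exp (-(β / (1 - S y))) ∂μ) :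
    0 < J0 ∧ 0 ≤ J2 / J0 - (J1 / J0) ^ 2 ∧
      J2 / J0 - (J1 / J0) ^ 2 ≤ 2 * Real.exp (β / δ) * ProbabilityTheory.variance S μ := by
  set E : Ω → ℝ := fun y => Real.exp (-(β / (1 - S y))) with hE
  have hEm : Measurable E := by simp only [hE]; fun_prop
  have hE0 : ∀ y, 0 < E y := fun y => Real.exp_pos _
  have hE1 : ∀ y ∈ D, E y ≤ 1 := by
    intro y hy
    apply Real.exp_le_one_iff.2
    have := (hD1 y hy).2
    have : 0 < β / (1 - S y) := div_pos hβ (by linarith)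
    linarith
  have i0 : Integrable E (μ.restrict D) := by
    refine Integrable.mono' (integrable_const (1:ℝ)) hEm.aestronglyMeasurable ?_
    refine (ae_restrict_mem hD).mono fun y hy => ?_
    rw [Real.norm_of_nonneg (hE0 y).le]; exact hE1 y hy
  have ik : ∀ k : ℕ, Integrable (fun y => (1 - S y) ^ k * E y) (μ.restrict D) := by
    intro k
    refine Integrable.mono' (integrable_const (1:ℝ)) (by fun_prop) ?_
    refine (ae_restrict_mem hD).mono fun y hy => ?_
    have := hD1 y hy
    have h3 : 0 ≤ 1 - S y := by linarith
    rw [Real.norm_of_nonneg (mul_nonneg (pow_nonneg h3 k) (hE0 y).le)]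
    exact mul_le_one₀ (pow_le_one₀ h3 (by linarith)) (hE0 y).le (hE1 y hy)
  have i1 : Integrable (fun y => (1 - S y) * E y) (μ.restrict D) := by simpa using ik 1
  have i2 := ik 2
  have quad : ∀ a : ℝ, ∫ y in D, ((1 - S y) - a) ^ 2 * E y ∂μ = J2 - 2 * a * J1 + a ^ 2 * J0 := by
    intro a
    have e : ∀ y, ((1 - S y) - a) ^ 2 * E y =
        ((1 - S y) ^ 2 * E y - 2 * a * ((1 - S y) * E y)) + a ^ 2 * E y := fun y => by ring
    simp only [e]
    rw [integral_add (f := fun y => (1 - S y) ^ 2 * E y - 2 * a * ((1 - S y) * E y))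
      (i2.sub (i1.const_mul _)) (i0.const_mul _), integral_sub i2 (i1.const_mul _),
      integral_const_mul, integral_const_mul, h0, h1, h2]
  have quad0 : ∀ a : ℝ, 0 ≤ J2 - 2 * a * J1 + a ^ 2 * J0 := by
    intro a
    rw [← quad]
    exact integral_nonneg fun y => mul_nonneg (sq_nonneg _) (hE0 y).le
  set m := ∫ y, S y ∂μ with hm
  set V := ProbabilityTheory.variance S μ with hV
  have hV0 : 0 ≤ V := ProbabilityTheory.variance_nonneg _ _
  -- lower bound on J0
  have hJ0 : Real.exp (-(β / δ)) / 2 ≤ J0 := by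
    set A := {y | δ ≤ |S y - m|} with hA
    have hAm : MeasurableSet A := measurableSet_le measurable_const (by fun_prop)
    have hch : μ A ≤ ENNReal.ofReal (V / δ ^ 2) := ProbabilityTheory.meas_ge_le_variance_div_sq hS hδ
    have hch2 : μ.real A ≤ 1 / 2 := by
      have h5 : V / δ ^ 2 ≤ 1 / 2 := by rw [div_le_iff₀ (by positivity)]; linarith
      have := ENNReal.toReal_mono ENNReal.ofReal_ne_top hch
      rw [ENNReal.toReal_ofReal (by positivity)] at this
      exact this.trans h5
    have hAc : 1 / 2 ≤ μ.real Aᶜ := by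
      rw [probReal_compl_eq_one_sub hAm]; linarith
    have hsub : ∀ᵐ y ∂μ, y ∈ Aᶜ → y ∈ D := by
      filter_upwards [hD2] with y hy hyA
      apply hy
      have : |S y - m| < δ := by simpa [hA] using hyA
      have := (abs_lt.1 this).2
      linarith
    calc Real.exp (-(β / δ)) / 2 ≤ μ.real Aᶜ * Real.exp (-(β / δ)) := by
          nlinarith [Real.exp_pos (-(β / δ))]
      _ = ∫ y in Aᶜ, Real.exp (-(β / δ)) ∂μ := by rw [setIntegral_const, smul_eq_mul]
      _ ≤ ∫ y in Aᶜ, E y ∂μ := by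
          refine setIntegral_mono_on_ae (integrable_const _) ?_ hAm.compl ?_
          · exact IntegrableOn.mono_set_ae i0 (by filter_upwards [hsub] with y hy using hy)
          · filter_upwards with y hyA
            apply Real.exp_le_exp.2
            have : |S y - m| < δ := by simpa [hA] using hyA
            have := (abs_lt.1 this).2
            have : β / (1 - S y) ≤ β / δ := by
              apply div_le_div_of_nonneg_left hβ.le hδ; linarith
            linarith
      _ ≤ ∫ y in D, E y ∂μ := by
          refine setIntegral_mono_set i0 (Eventually.of_forall fun y => (hE0 y).le) ?_
          filter_upwards [hsub] with y hy using hy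
      _ = J0 := h0.symm
  have hJ0p : 0 < J0 := lt_of_lt_of_le (by positivity) hJ0
  refine ⟨hJ0p, ?_, ?_⟩
  · have := quad0 (J1 / J0)
    have e : J2 / J0 - (J1 / J0) ^ 2 = (J2 - 2 * (J1 / J0) * J1 + (J1 / J0) ^ 2 * J0) / J0 := by
      field_simp; ring
    rw [e]; positivity
  · have hle : J2 - 2 * (1 - m) * J1 + (1 - m) ^ 2 * J0 ≤ V := by
      rw [← quad, hV, ProbabilityTheory.variance_eq_integral hSm.aemeasurable]
      have hintg : Integrable (fun y => (S y - m) ^ 2) μ := (hS.sub (memLp_const m)).integrable_sq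
      calc ∫ y in D, ((1 - S y) - (1 - m)) ^ 2 * E y ∂μ ≤ ∫ y in D, (S y - m) ^ 2 ∂μ := by
            refine integral_mono_of_nonneg (Eventually.of_forall fun y =>
              mul_nonneg (sq_nonneg _) (hE0 y).le) hintg.restrict ?_
            refine (ae_restrict_mem hD).mono fun y hy => ?_
            have := hE1 y hy
            calc ((1 - S y) - (1 - m)) ^ 2 * E y ≤ ((1 - S y) - (1 - m)) ^ 2 * 1 := by gcongr
              _ = (S y - m) ^ 2 := by ring
        _ ≤ ∫ y, (S y - m) ^ 2 ∂μ :=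
            setIntegral_le_integral hintg (Eventually.of_forall fun y => sq_nonneg _)
    have e : J2 / J0 - (J1 / J0) ^ 2 = (J2 - 2 * (1 - m) * J1 + (1 - m) ^ 2 * J0) / J0
        - (J1 / J0 - (1 - m)) ^ 2 := by
      field_simp; ring
    have h7 : (J2 - 2 * (1 - m) * J1 + (1 - m) ^ 2 * J0) / J0 ≤ 2 * Real.exp (β / δ) * V := by
      rw [div_le_iff₀ hJ0p]
      refine hle.trans ?_
      have h8 : Real.exp (β / δ) * Real.exp (-(β / δ)) = 1 := by rw [← Real.exp_add]; simp
      have h9 : 1 ≤ 2 * Real.exp (β / δ) * J0 := by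
        nlinarith [Real.exp_pos (β / δ)]
      nlinarith
    rw [e]
    nlinarith [sq_nonneg (J1 / J0 - (1 - m))]

/-- Weak supercritical force `F = F₀N`, `F₀ > 4β`: the variance of the first spacing is
`O(N^{−3/4})`. -/
theorem var_first_spacing_supercritical (β F₀ : ℝ) (hβ : 0 < β) (hF₀ : 4 * β < F₀) :
    ∃ C > (0:ℝ), ∃ N₀ : ℕ, ∀ N ≥ N₀,
      0 ≤ condVar β N (F₀ * N) 1 ∧
      condVar β N (F₀ * N) 1 ≤ C * (N : ℝ) ^ (-(3:ℝ)/4) := by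
  have hF : 0 < F₀ := by linarith
  set q := Real.sqrt (β / F₀) with hq
  have hq1 : 2 * q < 1 := by
    have : q < 1 / 2 := by
      rw [hq, Real.sqrt_lt' (by norm_num), div_lt_iff₀ hF]; linarith
    linarith
  set δ := (1 - 2 * q) / 3 with hδdef
  have hδ : 0 < δ := by rw [hδdef]; linarith
  have hδ1 : δ ≤ 1 := by rw [hδdef]; linarith [Real.sqrt_nonneg (β / F₀)]
  refine ⟨2 * Real.exp (β / δ) * F₀⁻¹, by positivity, ?_⟩
  have ev : ∀ᶠ N : ℕ in atTop, 2 ≤ N ∧ 4 / (F₀ * δ) ≤ Real.sqrt (N : ℝ) ∧ 2 / (F₀ * δ ^ 2) ≤ (N : ℝ) := by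
    refine (eventually_ge_atTop 2).and (Eventually.and ?_ ?_)
    · exact (Real.tendsto_sqrt_atTop.comp tendsto_natCast_atTop_atTop).eventually_ge_atTop _
    · exact tendsto_natCast_atTop_atTop.eventually_ge_atTop _
  obtain ⟨N₀, hN₀⟩ := eventually_atTop.1 ev
  refine ⟨N₀, fun N hN => ?_⟩
  obtain ⟨hN2, hNa, hNb⟩ := hN₀ N hN
  obtain ⟨n, rfl⟩ : ∃ n, N = n + 2 := ⟨N - 2, by omega⟩
  set M : ℝ := ((n + 2 : ℕ) : ℝ) with hM
  have hM1 : 1 ≤ M := by rw [hM]; push_cast; linarith [show (0:ℝ) ≤ n from Nat.cast_nonneg n]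
  have hM0 : 0 < M := by linarith
  have hFM : 0 < F₀ * M := by positivity
  have hc := cc_pos n hFM
  have hp : ∀ i, IsProbabilityMeasure (nu β (cc n (F₀ * M) i)) := fun i => nu_prob hβ (hc i)
  set μ := Measure.pi (fun i => nu β (cc n (F₀ * M) i)) with hμ
  set S : (Fin (n + 1) → ℝ) → ℝ := fun y => ∑ i, y i with hSdef
  have hSm : Measurable S := by simp only [hSdef]; fun_prop
  have hmp : ∀ i, MeasurePreserving (Function.eval i) μ (nu β (cc n (F₀ * M) i)) :=
    fun i => measurePreserving_eval _ i
  have hLp : ∀ i, MemLp (fun y : Fin (n + 1) → ℝ => y i) 2 μ := fun i =>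
    (nu_memLp hβ (hc i)).comp_measurePreserving (hmp i)
  have hS : MemLp S 2 μ := memLp_finsetSum _ fun i _ => hLp i
  have hmeanS : ∫ y, S y ∂μ = ∑ i, mm β (cc n (F₀ * M) i) := by
    simp only [hSdef]
    rw [integral_finsetSum _ fun i _ => (hLp i).integrable (by norm_num)]
    refine Finset.sum_congr rfl fun i _ => ?_
    rw [← nu_mean hβ (hc i)]
    exact integral_comp_eval (μ := fun i => nu β (cc n (F₀ * M) i)) (i := i) (f := fun t : ℝ => t)
      measurable_id.aestronglyMeasurable
  have hmean : ∫ y, S y ∂μ ≤ 1 - 2 * δ := by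
    rw [hmeanS]
    refine (mean_sum_le n hβ hF).trans ?_
    have hr : 0 < Real.sqrt M := Real.sqrt_pos.2 hM0
    have : 4 / (F₀ * Real.sqrt M) ≤ δ := by
      rw [div_le_iff₀ (by positivity)] at hNa ⊢
      linarith
    change 4 / (F₀ * Real.sqrt M) + 2 * q ≤ _
    rw [hδdef] at this ⊢
    linarith
  have hvarS : ProbabilityTheory.variance S μ ≤ F₀⁻¹ * M⁻¹ := by
    have e : S = ∑ i, fun y : Fin (n + 1) → ℝ => id (y i) := by
      ext y; simp [hSdef]
    rw [e, hμ, ProbabilityTheory.variance_sum_pi (X := fun _ => id) fun i => nu_memLp hβ (hc i)]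
    calc _ ≤ ∑ i, mm β (cc n (F₀ * M) i) / (F₀ * M) := by
          refine Finset.sum_le_sum fun i _ => (nu_var_le hβ (hc i)).trans ?_
          have := (mm_pos hβ (hc i)).le
          have := cc_ge n hFM i
          gcongr
      _ = (∫ y, S y ∂μ) / (F₀ * M) := by rw [hmeanS, Finset.sum_div]
      _ ≤ 1 / (F₀ * M) := by gcongr; linarith
      _ = _ := by field_simp
  have hvar : ProbabilityTheory.variance S μ ≤ δ ^ 2 / 2 := by
    refine hvarS.trans ?_
    rw [div_le_iff₀ (by positivity)] at hNb
    rw [← mul_inv, inv_le_comm₀ hFM (by positivity), inv_div, div_le_iff₀ (by positivity)]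
    linarith
  have hD1 : ∀ y ∈ coulombDomain (n + 2), 0 < S y ∧ S y < 1 := by
    intro y hy
    have := (mem_dom n y).1 hy
    exact ⟨Finset.sum_pos (fun i _ => this.1 i) Finset.univ_nonempty, this.2⟩
  have hD2 : ∀ᵐ y ∂μ, S y < 1 → y ∈ coulombDomain (n + 2) := by
    have : ∀ᵐ y ∂μ, ∀ i, 0 < y i := by
      rw [ae_all_iff]
      intro i
      exact (hmp i).quasiMeasurePreserving.ae (nu_pos _ _)
    filter_upwards [this] with y hy h
    exact (mem_dom n y).2 ⟨hy, h⟩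
  obtain ⟨K, hK, hKint⟩ := coulombInt_eq n hβ hFM
  obtain ⟨J0, h0⟩ : ∃ J, J = ∫ y in coulombDomain (n + 2), Real.exp (-(β / (1 - S y))) ∂μ := ⟨_, rfl⟩
  obtain ⟨J1, h1⟩ : ∃ J, J = ∫ y in coulombDomain (n + 2),
    (1 - S y) * Real.exp (-(β / (1 - S y))) ∂μ := ⟨_, rfl⟩
  obtain ⟨J2, h2⟩ : ∃ J, J = ∫ y in coulombDomain (n + 2),
    (1 - S y) ^ 2 * Real.exp (-(β / (1 - S y))) ∂μ := ⟨_, rfl⟩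
  obtain ⟨hJ0, hl, hu⟩ := abstract_bound μ S hSm hS _ (dom_meas n) hD1 hD2 β δ hβ hδ hmean hvar
    _ _ _ h0 h1 h2
  have hcv : condVar β (n + 2) (F₀ * M) 1 = J2 / J0 - (J1 / J0) ^ 2 := by
    unfold condVar condMean
    have hk : ∀ y, coulombCoord (n + 2) 1 (flipx n y) = 1 - S y := by
      intro y; unfold coulombCoord; rw [dif_pos (by simp)]; rfl
    rw [hKint, hKint, hKint]
    simp only [hk, one_mul]
    rw [mul_div_mul_left _ _ hK.ne', mul_div_mul_left _ _ hK.ne', h0, h1, h2]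
  rw [hcv]
  refine ⟨hl, hu.trans ?_⟩
  have h1 : M⁻¹ ≤ M ^ (-(3:ℝ)/4) := by
    rw [← Real.rpow_neg_one]
    exact Real.rpow_le_rpow_of_exponent_le hM1 (by norm_num)
  calc 2 * Real.exp (β / δ) * ProbabilityTheory.variance S μ
      ≤ 2 * Real.exp (β / δ) * (F₀⁻¹ * M⁻¹) := by gcongr
    _ ≤ 2 * Real.exp (β / δ) * (F₀⁻¹ * M ^ (-(3:ℝ)/4)) := by gcongr
    _ = _ := by ring
end
end
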